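/- arXiv:0706.0285 — 5 statements merged into one kernel-verified Lean document; each statement's English description precedes it below -/
import Mathlib

section
/- Let R be a ring and M a right R-module. Then: (i) if M is separable, then M is strict Mittag-Leffler; (ii) if M is strict Mittag-Leffler, then M is Mittag-Leffler. If moreover every finitely presented right R-module is pure-injective, then the three conditions — M is separable, M is strict Mittag-Leffler, M is Mittag-Leffler — are equivalent. -/
universe u

section MLDefs

variable (R : Type u) [Ring R]

/-- `π : X → M` is a locally split epimorphism: it is surjective and for every finite
subset `S` of `M` there is `φ : M → X` with `π (φ m) = m` for all `m ∈ S`. -/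
def IsLocallySplitEpi {X M : Type u} [AddCommGroup X] [Module R X]
    [AddCommGroup M] [Module R M] (π : X →ₗ[R] M) : Prop :=
  Function.Surjective π ∧
    ∀ S : Finset M, ∃ φ : M →ₗ[R] X, ∀ m ∈ S, π (φ m) = m

/-- `π : X → M` is a pure epimorphism: it is surjective and every homomorphism from a
finitely presented module to `M` factors through `π`. -/
def IsPureEpi {X M : Type u} [AddCommGroup X] [Module R X]
    [AddCommGroup M] [Module R M] (π : X →ₗ[R] M) : Prop :=
  Function.Surjective π ∧
    ∀ (F : Type u) [AddCommGroup F] [Module R F], Module.FinitePresentation R F →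
      ∀ g : F →ₗ[R] M, ∃ h : F →ₗ[R] X, π.comp h = g

/-- A submodule `N` of `M` is a direct summand if the inclusion splits. -/
def IsDirectSummand {M : Type u} [AddCommGroup M] [Module R M] (N : Submodule R M) : Prop :=
  ∃ ρ : M →ₗ[R] N, ∀ n : N, ρ (n : M) = n

/-- `M` is separable: every finite subset of `M` is contained in a finitely presented
direct summand of `M`. -/
def IsSeparableModule (M : Type u) [AddCommGroup M] [Module R M] : Prop :=
  ∀ S : Finset M, ∃ N : Submodule R M, (S : Set M) ⊆ (N : Set M) ∧
    Module.FinitePresentation R N ∧ IsDirectSummand R N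

/-- `M` is strict Mittag-Leffler: every pure epimorphism onto `M` is locally split. -/
def IsStrictMittagLeffler (M : Type u) [AddCommGroup M] [Module R M] : Prop :=
  ∀ (X : Type u) [AddCommGroup X] [Module R X] (π : X →ₗ[R] M),
    IsPureEpi R π → IsLocallySplitEpi R π

/-- `(F, u)` is a directed system of modules over the preordered index set `I`. -/
def IsDirectedSystem {I : Type u} [Preorder I] (F : I → ModuleCat.{u} R)
    (u : ∀ i j : I, i ≤ j → ((F i : Type u) →ₗ[R] (F j : Type u))) : Prop :=
  (∀ i, u i i le_rfl = LinearMap.id) ∧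
    (∀ (i j k : I) (hij : i ≤ j) (hjk : j ≤ k),
      (u j k hjk).comp (u i j hij) = u i k (hij.trans hjk))

/-- `M`, together with the compatible family of maps `g i : F i → M`, is the direct limit
of the directed system `(F, u)`. -/
def IsDirectLimit {I : Type u} [Preorder I] (F : I → ModuleCat.{u} R)
    (u : ∀ i j : I, i ≤ j → ((F i : Type u) →ₗ[R] (F j : Type u)))
    (M : Type u) [AddCommGroup M] [Module R M]
    (g : ∀ i, (F i : Type u) →ₗ[R] M) : Prop :=
  (∀ (i j : I) (hij : i ≤ j), (g j).comp (u i j hij) = g i) ∧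
    (∀ m : M, ∃ (i : I) (x : F i), g i x = m) ∧
    (∀ (i : I) (x : F i), g i x = 0 → ∃ (j : I) (hij : i ≤ j), u i j hij x = 0)

/-- The inverse system `(Hom_R(F i, B), − ∘ u i j)` satisfies the Mittag-Leffler condition. -/
def HomSystemMittagLeffler {I : Type u} [Preorder I] (F : I → ModuleCat.{u} R)
    (u : ∀ i j : I, i ≤ j → ((F i : Type u) →ₗ[R] (F j : Type u)))
    (B : Type u) [AddCommGroup B] [Module R B] : Prop :=
  ∀ i : I, ∃ (j : I) (hij : i ≤ j), ∀ (k : I) (hjk : j ≤ k),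
    (Set.range fun f : (F k : Type u) →ₗ[R] B => f.comp (u i k (hij.trans hjk))) =
      (Set.range fun f : (F j : Type u) →ₗ[R] B => f.comp (u i j hij))

/-- `M` is a Mittag-Leffler module (Raynaud–Gruson characterization): `M` is the direct
limit of a directed system of finitely presented modules such that for every module `B`
the associated inverse system of Hom-sets satisfies the Mittag-Leffler condition. -/
def IsMittagLeffler (M : Type u) [AddCommGroup M] [Module R M] : Prop :=
  ∃ (I : Type u) (_ : Preorder I) (_ : IsDirected I (· ≤ ·)) (_ : Nonempty I)
    (F : I → ModuleCat.{u} R)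
    (u : ∀ i j : I, i ≤ j → ((F i : Type u) →ₗ[R] (F j : Type u)))
    (g : ∀ i, (F i : Type u) →ₗ[R] M),
      (∀ i, Module.FinitePresentation R (F i)) ∧
      IsDirectedSystem R F u ∧ IsDirectLimit R F u M g ∧
      ∀ (B : Type u) [AddCommGroup B] [Module R B], HomSystemMittagLeffler R F u B

/-- `N` is pure-injective: whenever `N` embeds in a module `X` such that the quotient map
`X → X/N` is a pure epimorphism, the embedding splits. -/
def IsPureInjective (N : Type u) [AddCommGroup N] [Module R N] : Prop :=
  ∀ (X : Type u) [AddCommGroup X] [Module R X] (ι : N →ₗ[R] X),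
    Function.Injective ι → IsPureEpi R (LinearMap.range ι).mkQ →
      ∃ ρ : X →ₗ[R] N, ρ.comp ι = LinearMap.id

end MLDefs

namespace MittagLefflerAux

variable {R : Type u} [Ring R]

theorem exists_factor_of_ker_le {P A B : Type*} [AddCommGroup P] [Module R P] [AddCommGroup A]
    [Module R A] [AddCommGroup B] [Module R B] {f : P →ₗ[R] A} (hf : Function.Surjective f)
    {h : P →ₗ[R] B} (hk : LinearMap.ker f ≤ LinearMap.ker h) :
    ∃ h' : A →ₗ[R] B, h'.comp f = h := by
  refine ⟨((LinearMap.ker f).liftQ h hk).comp (f.quotKerEquivOfSurjective hf).symm.toLinearMap, ?_⟩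
  ext x
  have : (f.quotKerEquivOfSurjective hf).symm (f x) = (LinearMap.ker f).mkQ x := by
    rw [LinearEquiv.symm_apply_eq]; rfl
  simp [this]

/-! ### Directed systems -/

section DirectLimit

variable {I : Type u} [Preorder I] {F : I → ModuleCat.{u} R}
  {u : ∀ i j : I, i ≤ j → ((F i : Type u) →ₗ[R] (F j : Type u))}
  {M : Type u} [AddCommGroup M] [Module R M] {g : ∀ i, (F i : Type u) →ₗ[R] M}

theorem exists_comp_eq_zero_on_fg [IsDirected I (· ≤ ·)] (hu : IsDirectedSystem R F u)
    (hg : IsDirectLimit R F u M g) {A : Type u} [AddCommGroup A] [Module R A]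
    {K : Submodule R A} (hK : K.FG) {i : I} (h : A →ₗ[R] F i)
    (hz : ∀ x ∈ K, g i (h x) = 0) :
    ∃ (j : I) (hij : i ≤ j), ∀ x ∈ K, u i j hij (h x) = 0 := by
  obtain ⟨s, rfl⟩ := hK
  have key : ∀ x : s, ∃ (j : I) (hij : i ≤ j), u i j hij (h x) = 0 := fun x =>
    hg.2.2 i _ (hz x (Submodule.subset_span x.2))
  choose j hij hj using key
  have : Nonempty I := ⟨i⟩
  obtain ⟨k₀, hk₀⟩ := Finite.exists_le j
  obtain ⟨k, hik, hkk⟩ := exists_ge_ge i k₀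
  refine ⟨k, hik, ?_⟩
  have hle : Submodule.span R (s : Set A) ≤ LinearMap.ker ((u i k hik).comp h) := by
    rw [Submodule.span_le]
    intro x hx
    have hjk : j ⟨x, hx⟩ ≤ k := (hk₀ _).trans hkk
    have := hj ⟨x, hx⟩
    simp only [SetLike.mem_coe, LinearMap.mem_ker, LinearMap.comp_apply]
    rw [← hu.2 i _ k (hij ⟨x, hx⟩) hjk, LinearMap.comp_apply, this, map_zero]
  exact fun x hx => hle hx

theorem exists_factor_of_finitePresentation [IsDirected I (· ≤ ·)] [Nonempty I]
    (hu : IsDirectedSystem R F u) (hg : IsDirectLimit R F u M g)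
    {A : Type u} [AddCommGroup A] [Module R A] (hA : Module.FinitePresentation R A)
    (f : A →ₗ[R] M) : ∃ (i : I) (h : A →ₗ[R] F i), (g i).comp h = f := by
  obtain ⟨s, hs, hK⟩ := hA.out
  have hsurj : Function.Surjective (Finsupp.linearCombination R ((↑) : s → A)) := by
    rw [← LinearMap.range_eq_top, Finsupp.range_linearCombination]
    simpa using hs
  choose k x hx using fun a : s => hg.2.1 (f a)
  obtain ⟨i, hi⟩ := Finite.exists_le k
  let v : (s →₀ R) →ₗ[R] F i := Finsupp.linearCombination R fun a => u _ i (hi a) (x a)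
  have hv : (g i).comp v = f.comp (Finsupp.linearCombination R ((↑) : s → A)) := by
    ext a
    have := LinearMap.congr_fun (hg.1 _ i (hi a)) (x a)
    simp only [LinearMap.comp_apply] at this
    simp [v, this, hx]
  obtain ⟨j, hij, hj⟩ := exists_comp_eq_zero_on_fg hu hg hK v fun y hy => by
    have := LinearMap.congr_fun hv y
    simp only [LinearMap.comp_apply, LinearMap.mem_ker.1 hy, map_zero] at this
    exact this
  obtain ⟨h, hh⟩ := exists_factor_of_ker_le (h := (u i j hij).comp v) hsurj fun y hy => hj y hy
  refine ⟨j, h, ?_⟩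
  rw [← LinearMap.cancel_right hsurj, LinearMap.comp_assoc, hh, ← LinearMap.comp_assoc,
    hg.1, hv]

theorem exists_desc [IsDirected I (· ≤ ·)] (hg : IsDirectLimit R F u M g)
    {B : Type u} [AddCommGroup B] [Module R B] (w : ∀ i, (F i : Type u) →ₗ[R] B)
    (hw : ∀ i j hij, (w j).comp (u i j hij) = w i) :
    ∃ θ : M →ₗ[R] B, ∀ i, θ.comp (g i) = w i := by
  have hgu : ∀ i j hij x, g j (u i j hij x) = g i x := fun i j hij x =>
    LinearMap.congr_fun (hg.1 i j hij) x
  have hwu : ∀ i j hij x, w j (u i j hij x) = w i x := fun i j hij x =>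
    LinearMap.congr_fun (hw i j hij) x
  have hwell : ∀ i (x : F i) j (y : F j), g i x = g j y → w i x = w j y := by
    intro i x j y hxy
    obtain ⟨k, hik, hjk⟩ := exists_ge_ge i j
    obtain ⟨l, hkl, hl⟩ := hg.2.2 k (u i k hik x - u j k hjk y) (by
      rw [map_sub, hgu, hgu, hxy, sub_self])
    have := congrArg (w l) hl
    rwa [hwu, map_zero, map_sub, hwu, hwu, sub_eq_zero] at this
  choose k x hx using hg.2.1
  refine ⟨{ toFun := fun m => w (k m) (x m), map_add' := ?_, map_smul' := ?_ }, ?_⟩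
  · intro m n
    obtain ⟨l, h₁, h₂⟩ := exists_ge_ge (k m) (k n)
    rw [← hwu _ l h₁, ← hwu _ l h₂, ← map_add]
    exact hwell _ _ _ _ (by rw [hx, map_add, hgu, hgu, hx, hx])
  · intro r m
    rw [RingHom.id_apply, ← map_smul]
    exact hwell _ _ _ _ (by rw [hx, map_smul, hx])
  · intro i
    ext y
    exact hwell _ _ _ _ (hx _)

theorem exists_preimage_finset [IsDirected I (· ≤ ·)] [Nonempty I]
    (hg : IsDirectLimit R F u M g) (S : Finset M) :
    ∃ i, ∀ m ∈ S, ∃ x : F i, g i x = m := by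
  choose k x hx using hg.2.1
  obtain ⟨i, hi⟩ := Finite.exists_le fun m : S => k m
  exact ⟨i, fun m hm => ⟨u _ i (hi ⟨m, hm⟩) (x m),
    (LinearMap.congr_fun (hg.1 _ i (hi ⟨m, hm⟩)) (x m)).trans (hx m)⟩⟩

end DirectLimit

/-! ### Every module is a directed limit of finitely presented modules -/

section Presentation

section FreeModule

variable (R : Type u) [Ring R] (M : Type u)

/-- The map from the free module on a finite set of elements of `M` to the free module on `M`. -/
noncomputable def freeIncl (S : Finset M) : (S →₀ R) →ₗ[R] (M →₀ R) :=
  Finsupp.lmapDomain R R Subtype.val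

theorem freeIncl_injective (S : Finset M) : Function.Injective (freeIncl R M S) :=
  Finsupp.mapDomain_injective Subtype.val_injective

variable {M}

/-- The inclusion of free modules induced by an inclusion of finite sets. -/
noncomputable def freeMap {S T : Finset M} (h : S ⊆ T) : (S →₀ R) →ₗ[R] (T →₀ R) :=
  Finsupp.lmapDomain R R fun x => ⟨x, h x.2⟩

theorem freeIncl_comp_freeMap {S T : Finset M} (h : S ⊆ T) :
    (freeIncl R M T).comp (freeMap R h) = freeIncl R M S := by
  ext x : 2
  simp [freeIncl, freeMap]

theorem freeMap_comp_freeMap {S T U : Finset M} (h : S ⊆ T) (h' : T ⊆ U) :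
    (freeMap R h').comp (freeMap R h) = freeMap R (h.trans h') := by
  ext x : 2
  simp [freeMap]

theorem freeMap_refl (S : Finset M) : freeMap R (Finset.Subset.refl S) = LinearMap.id := by
  ext x : 2
  simp [freeMap]

theorem range_freeIncl_mono {S T : Finset M} (h : S ⊆ T) :
    LinearMap.range (freeIncl R M S) ≤ LinearMap.range (freeIncl R M T) := by
  rw [← freeIncl_comp_freeMap R h]
  exact LinearMap.range_comp_le_range _ _

end FreeModule

variable (R) (M : Type u) [AddCommGroup M] [Module R M]

/-- Finitely presented approximations of `M`: a finite set of elements of `M`, and a finitely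
generated module of relations among them. -/
structure FPApprox where
  /-- The generators. -/
  gens : Finset M
  /-- The relations. -/
  rels : Submodule R (M →₀ R)
  rels_fg : rels.FG
  rels_le_range : rels ≤ LinearMap.range (freeIncl R M gens)
  rels_le_ker : rels ≤ LinearMap.ker (Finsupp.linearCombination R (id : M → M))

namespace FPApprox

noncomputable instance : Preorder (FPApprox R M) :=
  Preorder.lift fun a => (a.gens, a.rels)

variable {R M}

theorem le_def {a b : FPApprox R M} : a ≤ b ↔ a.gens ⊆ b.gens ∧ a.rels ≤ b.rels := Iff.rfl

instance : Nonempty (FPApprox R M) := ⟨⟨∅, ⊥, Submodule.fg_bot, bot_le, bot_le⟩⟩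

instance : IsDirected (FPApprox R M) (· ≤ ·) := by
  classical
  refine ⟨fun a b => ⟨⟨a.gens ∪ b.gens, a.rels ⊔ b.rels, a.rels_fg.sup b.rels_fg, ?_,
    sup_le a.rels_le_ker b.rels_le_ker⟩, ?_, ?_⟩⟩
  · exact sup_le
      (a.rels_le_range.trans (range_freeIncl_mono R Finset.subset_union_left))
      (b.rels_le_range.trans (range_freeIncl_mono R Finset.subset_union_right))
  · exact le_def.2 ⟨Finset.subset_union_left, le_sup_left⟩
  · exact le_def.2 ⟨Finset.subset_union_right, le_sup_right⟩

/-- The relations, as a submodule of the free module on the generators. -/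
noncomputable def relsIn (a : FPApprox R M) : Submodule R (a.gens →₀ R) :=
  a.rels.comap (freeIncl R M a.gens)

/-- The module with the given generators and relations. -/
noncomputable def obj (a : FPApprox R M) : ModuleCat.{u} R :=
  ModuleCat.of R ((a.gens →₀ R) ⧸ a.relsIn)

/-- The quotient map from the free module on the generators. -/
noncomputable def proj (a : FPApprox R M) : (a.gens →₀ R) →ₗ[R] (a.obj : Type u) :=
  a.relsIn.mkQ

theorem proj_surjective (a : FPApprox R M) : Function.Surjective a.proj :=
  Submodule.mkQ_surjective a.relsIn

theorem ker_proj (a : FPApprox R M) :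
    LinearMap.ker a.proj = a.rels.comap (freeIncl R M a.gens) :=
  Submodule.ker_mkQ a.relsIn

/-- The transition maps between the approximations. -/
noncomputable def trans (a b : FPApprox R M) (h : a ≤ b) :
    (a.obj : Type u) →ₗ[R] (b.obj : Type u) :=
  Submodule.mapQ a.relsIn b.relsIn (freeMap R h.1) fun x hx => by
    have := LinearMap.congr_fun (freeIncl_comp_freeMap R h.1) x
    rw [LinearMap.comp_apply] at this
    change freeIncl R M b.gens (freeMap R h.1 x) ∈ b.rels
    rw [this]
    exact h.2 hx

/-- The comparison map to `M`. -/
noncomputable def toModule (a : FPApprox R M) : (a.obj : Type u) →ₗ[R] M :=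
  a.relsIn.liftQ ((Finsupp.linearCombination R (id : M → M)).comp (freeIncl R M a.gens))
    fun _ hx => a.rels_le_ker hx

theorem trans_comp_proj {a b : FPApprox R M} (h : a ≤ b) :
    (trans a b h).comp a.proj = b.proj.comp (freeMap R h.1) := rfl

theorem toModule_comp_proj (a : FPApprox R M) :
    a.toModule.comp a.proj =
      (Finsupp.linearCombination R (id : M → M)).comp (freeIncl R M a.gens) := rfl

theorem finitePresentation_obj (a : FPApprox R M) : Module.FinitePresentation R a.obj := by
  refine Module.finitePresentation_of_surjective a.proj a.proj_surjective ?_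
  refine Submodule.fg_of_fg_map_injective _ (freeIncl_injective R M a.gens) ?_
  rw [ker_proj, Submodule.map_comap_eq, inf_eq_right.2 a.rels_le_range]
  exact a.rels_fg

theorem isDirectedSystem : IsDirectedSystem R (obj : FPApprox R M → _) trans := by
  constructor
  · intro a
    rw [← LinearMap.cancel_right a.proj_surjective, trans_comp_proj, freeMap_refl]
    rfl
  · intro a b c hab hbc
    rw [← LinearMap.cancel_right a.proj_surjective, LinearMap.comp_assoc, trans_comp_proj,
      ← LinearMap.comp_assoc, trans_comp_proj, LinearMap.comp_assoc, freeMap_comp_freeMap,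
      trans_comp_proj]

theorem isDirectLimit : IsDirectLimit R (obj : FPApprox R M → _) trans M toModule := by
  refine ⟨?_, ?_, ?_⟩
  · intro a b hab
    rw [← LinearMap.cancel_right a.proj_surjective, LinearMap.comp_assoc, trans_comp_proj,
      ← LinearMap.comp_assoc, toModule_comp_proj, LinearMap.comp_assoc, freeIncl_comp_freeMap,
      toModule_comp_proj]
  · intro m
    let a : FPApprox R M := ⟨{m}, ⊥, Submodule.fg_bot, bot_le, bot_le⟩
    let x : a.gens →₀ R := Finsupp.single ⟨m, Finset.mem_singleton_self m⟩ 1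
    refine ⟨a, a.proj x, (LinearMap.congr_fun a.toModule_comp_proj x).trans ?_⟩
    simp [freeIncl, x]
  · intro a x hx
    obtain ⟨y, rfl⟩ := a.proj_surjective x
    have hy : Finsupp.linearCombination R (id : M → M) (freeIncl R M a.gens y) = 0 := hx
    let b : FPApprox R M := ⟨a.gens, a.rels ⊔ Submodule.span R {freeIncl R M a.gens y},
      a.rels_fg.sup (Submodule.fg_span_singleton _),
      sup_le a.rels_le_range (by simp [Submodule.span_le]),
      sup_le a.rels_le_ker (by simpa [Submodule.span_le] using hy)⟩
    have hab : a ≤ b := le_def.2 ⟨subset_rfl, le_sup_left⟩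
    refine ⟨b, hab, (LinearMap.congr_fun (trans_comp_proj hab) y).trans ?_⟩
    rw [LinearMap.comp_apply, ← LinearMap.mem_ker, ker_proj, Submodule.mem_comap,
      ← LinearMap.comp_apply, freeIncl_comp_freeMap]
    exact (le_sup_right : _ ≤ a.rels ⊔ Submodule.span R {freeIncl R M a.gens y})
      (Submodule.mem_span_singleton_self _)

end FPApprox

end Presentation

/-! ### Limits in pure-injective modules -/

/-- Families of elements of `N` that vanish eventually along a filter. -/
def eventuallyZero (R : Type u) [Ring R] {ι : Type u} (l : Filter ι) (N : Type u)
    [AddCommGroup N] [Module R N] : Submodule R (ι → N) where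
  carrier := {v | ∀ᶠ i in l, v i = 0}
  zero_mem' := by simp
  add_mem' := fun ha hb => by filter_upwards [ha, hb] with i hi hj; simp [hi, hj]
  smul_mem' := fun r _ ha => by filter_upwards [ha] with i hi; simp [hi]

section PureInjective

variable {ι : Type u} (l : Filter ι) (N : Type u) [AddCommGroup N] [Module R N]

/-- The diagonal embedding of `N` into the reduced power along a filter. -/
def diagonal : N →ₗ[R] (ι → N) ⧸ eventuallyZero R l N :=
  (eventuallyZero R l N).mkQ.comp (LinearMap.pi fun _ => LinearMap.id)

theorem isPureEpi_mkQ_range_diagonal [l.NeBot] :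
    IsPureEpi R (LinearMap.range (diagonal (R := R) l N)).mkQ := by
  refine ⟨Submodule.mkQ_surjective _, fun A _ _ hA γ => ?_⟩
  obtain ⟨s, hs, hK⟩ := hA.out
  have hsurj : Function.Surjective (Finsupp.linearCombination R ((↑) : s → A)) := by
    rw [← LinearMap.range_eq_top, Finsupp.range_linearCombination]
    simpa using hs
  set q := (eventuallyZero R l N).mkQ
  set p := (LinearMap.range (diagonal (R := R) l N)).mkQ
  have hpq : Function.Surjective (p.comp q) :=
    (Submodule.mkQ_surjective _).comp (Submodule.mkQ_surjective _)
  choose v hv using fun a : s => hpq (γ a)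
  let w : (s →₀ R) →ₗ[R] (ι → N) := Finsupp.linearCombination R v
  have hw : (p.comp q).comp w = γ.comp (Finsupp.linearCombination R ((↑) : s → A)) := by
    ext a
    simpa [w] using hv a
  obtain ⟨T, hT⟩ := hK
  have hconst : ∀ x ∈ T, ∃ d : N, ∀ᶠ i in l, w x i = d := by
    intro x hx
    have hx0 : Finsupp.linearCombination R ((↑) : s → A) x = 0 := by
      rw [← LinearMap.mem_ker, ← hT]; exact Submodule.subset_span hx
    have h0 := LinearMap.congr_fun hw x
    simp only [LinearMap.comp_apply, hx0, map_zero] at h0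
    obtain ⟨d, hd⟩ := (Submodule.Quotient.mk_eq_zero _).1 h0
    refine ⟨d, ?_⟩
    have hd' := (Submodule.Quotient.eq _).1 hd
    have hd'' : ∀ᶠ i in l, d - w x i = 0 := hd'
    filter_upwards [hd''] with i hi
    exact (sub_eq_zero.1 hi).symm
  choose! d hd using hconst
  obtain ⟨i, hi⟩ := ((Filter.eventually_all_finset T).2 hd).exists
  let w' : (s →₀ R) →ₗ[R] (ι → N) :=
    w - (LinearMap.pi fun _ => LinearMap.id).comp ((LinearMap.proj i).comp w)
  have hker : LinearMap.ker (Finsupp.linearCombination R ((↑) : s → A)) ≤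
      LinearMap.ker (q.comp w') := by
    rw [← hT, Submodule.span_le]
    intro x hx
    refine (Submodule.Quotient.mk_eq_zero _).2 ?_
    change ∀ᶠ k in l, w x k - w x i = 0
    filter_upwards [hd x hx] with k hk
    rw [hk, hi x hx, sub_self]
  obtain ⟨h, hh⟩ := exists_factor_of_ker_le hsurj hker
  refine ⟨h, ?_⟩
  rw [← LinearMap.cancel_right hsurj, LinearMap.comp_assoc, hh, ← hw]
  refine LinearMap.ext fun x => ?_
  change p (q (w x - _)) = p (q (w x))
  rw [map_sub, map_sub, sub_eq_self]
  exact (Submodule.Quotient.mk_eq_zero _).2 ⟨w x i, rfl⟩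

variable {N}

/-- A pure-injective module admits linear limits along every proper filter. -/
theorem exists_limit (hN : IsPureInjective R N) [l.NeBot] :
    ∃ L : (ι → N) →ₗ[R] N, (∀ x, L (fun _ => x) = x) ∧
      ∀ v w, (∀ᶠ i in l, v i = w i) → L v = L w := by
  obtain ⟨ρ, hρ⟩ := hN _ (diagonal (R := R) l N) (by
    rw [← LinearMap.ker_eq_bot, LinearMap.ker_eq_bot']
    intro x hx
    have : ∀ᶠ _ in l, x = 0 := (Submodule.Quotient.mk_eq_zero _).1 hx
    exact this.exists.choose_spec) (isPureEpi_mkQ_range_diagonal l N)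
  refine ⟨ρ.comp (eventuallyZero R l N).mkQ, fun x => LinearMap.congr_fun hρ x, fun v w h => ?_⟩
  refine congrArg ρ ((Submodule.Quotient.eq _).2 ?_)
  change ∀ᶠ i in l, v i - w i = 0
  filter_upwards [h] with i hi
  rw [hi, sub_self]

/-- A set of endomorphisms of `N` closed under all pointwise linear limits. -/
def IsLimitClosed (S : Set (N →ₗ[R] N)) : Prop :=
  ∀ (κ : Type u) (L : (κ → N) →ₗ[R] N), (∀ x, L (fun _ => x) = x) →
    ∀ f : κ → N →ₗ[R] N, (∀ k, f k ∈ S) → L.comp (LinearMap.pi f) ∈ S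

/-- The analogue of the Ellis–Numakura lemma for endomorphisms of a pure-injective module. -/
theorem exists_idempotent_of_isLimitClosed (hN : IsPureInjective R N) {S : Set (N →ₗ[R] N)}
    (hne : S.Nonempty) (hcl : IsLimitClosed S) (hmul : ∀ f ∈ S, ∀ g ∈ S, f.comp g ∈ S) :
    ∃ e ∈ S, e.comp e = e := by
  let C : Set (Set (N →ₗ[R] N)) :=
    {S | S.Nonempty ∧ IsLimitClosed S ∧ ∀ f ∈ S, ∀ g ∈ S, f.comp g ∈ S}
  obtain ⟨T, hTS, hT⟩ := zorn_superset_nonempty C (by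
    intro c hcC hc hcne
    refine ⟨⋂₀ c, ⟨?_, ?_, ?_⟩, fun s hs => Set.sInter_subset_of_mem hs⟩
    · have : Nonempty c := hcne.to_subtype
      have : IsCodirectedOrder c := ⟨fun a b => by
        rcases hc.total a.2 b.2 with h | h
        · exact ⟨a, le_rfl, h⟩
        · exact ⟨b, h, le_rfl⟩⟩
      choose f hf using fun s : c => (hcC s.2).1
      obtain ⟨L, hL, hL'⟩ := exists_limit (Filter.atBot : Filter c) hN
      refine ⟨L.comp (LinearMap.pi f), ?_⟩
      intro s hs
      classical
      let f' : c → N →ₗ[R] N := fun k => if k ≤ ⟨s, hs⟩ then f k else f ⟨s, hs⟩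
      have hf' : ∀ k, f' k ∈ s := by
        intro k
        by_cases h : k ≤ ⟨s, hs⟩
        · simp only [f', if_pos h]; exact h (hf k)
        · simp only [f', if_neg h]; exact hf ⟨s, hs⟩
      convert (hcC hs).2.1 c L hL f' hf' using 1
      ext x
      refine hL' _ _ ?_
      filter_upwards [Filter.eventually_le_atBot (⟨s, hs⟩ : c)] with k hk
      simp [f', hk]
    · intro κ L hL f hf s hs
      exact (hcC hs).2.1 κ L hL f fun k => hf k s hs
    · intro f hf g hg s hs
      exact (hcC hs).2.2 f (hf s hs) g (hg s hs)) S ⟨hne, hcl, hmul⟩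
  obtain ⟨⟨⟨e, he⟩, hTcl, hTmul⟩, hmin⟩ := hT
  have h₁ : T ⊆ {f | ∃ s ∈ T, s.comp e = f} := by
    refine hmin ⟨⟨_, e, he, rfl⟩, ?_, ?_⟩ ?_
    · intro κ L hL f hf
      choose s hs hse using hf
      refine ⟨_, hTcl κ L hL s hs, ?_⟩
      obtain rfl : (fun k => (s k).comp e) = f := funext hse
      rfl
    · rintro _ ⟨s, hs, rfl⟩ _ ⟨s', hs', rfl⟩
      exact ⟨(s.comp e).comp s', hTmul _ (hTmul _ hs _ he) _ hs', rfl⟩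
    · rintro _ ⟨s, hs, rfl⟩
      exact hTmul _ hs _ he
  have h₂ : T ⊆ {f | f ∈ T ∧ f.comp e = e} := by
    refine hmin ⟨h₁ he, ?_, ?_⟩ fun f hf => hf.1
    · intro κ L hL f hf
      refine ⟨hTcl κ L hL f fun k => (hf k).1, ?_⟩
      ext x
      have : (fun k => f k (e x)) = fun _ => e x :=
        funext fun k => LinearMap.congr_fun (hf k).2 x
      exact (congrArg L this).trans (hL _)
    · rintro f ⟨hf, hfe⟩ f' ⟨hf', hfe'⟩
      exact ⟨hTmul _ hf _ hf', by rw [LinearMap.comp_assoc, hfe', hfe]⟩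
  exact ⟨e, hTS he, (h₂ he).2⟩

/-- For an endomorphism `a` of a pure-injective module there is an idempotent that fixes all
fixed points of `a` and is a left multiple of `a`. -/
theorem exists_idempotent_fixing (hN : IsPureInjective R N) (a : N →ₗ[R] N) :
    ∃ e c : N →ₗ[R] N, e.comp e = e ∧ c.comp a = e ∧ ∀ x, a x = x → e x = x := by
  obtain ⟨e, ⟨c, hc, hce⟩, he⟩ := exists_idempotent_of_isLimitClosed hN
    (S := {f | ∃ c : N →ₗ[R] N, (∀ x, a x = x → c x = x) ∧ c.comp a = f})
    ⟨_, LinearMap.id, fun _ _ => rfl, rfl⟩ (by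
      intro κ L hL f hf
      choose c hc hcf using hf
      refine ⟨L.comp (LinearMap.pi c), fun x hx => ?_, ?_⟩
      · have : (fun k => c k x) = fun _ => x := funext fun k => hc k x hx
        exact (congrArg L this).trans (hL _)
      · obtain rfl : (fun k => (c k).comp a) = f := funext hcf
        rfl) (by
      rintro _ ⟨c, hc, rfl⟩ _ ⟨c', hc', rfl⟩
      exact ⟨(c.comp a).comp c', fun x hx => by simp [hc' x hx, hx, hc x hx], rfl⟩)
  exact ⟨e, c, he, hce, fun x hx => by rw [← hce, LinearMap.comp_apply, hx, hc x hx]⟩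

end PureInjective

/-! ### The implications -/

variable {M : Type u} [AddCommGroup M] [Module R M]

theorem isStrictMittagLeffler_of_isSeparableModule (hM : IsSeparableModule R M) :
    IsStrictMittagLeffler R M := by
  intro X _ _ π hπ
  refine ⟨hπ.1, fun S => ?_⟩
  obtain ⟨N, hSN, hN, ρ, hρ⟩ := hM S
  obtain ⟨h, hh⟩ := hπ.2 N hN N.subtype
  refine ⟨h.comp ρ, fun m hm => ?_⟩
  rw [LinearMap.comp_apply, hρ ⟨m, hSN hm⟩]
  exact LinearMap.congr_fun hh _

section

variable {I : Type u} [Preorder I] {F : I → ModuleCat.{u} R}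
  {u : ∀ i j : I, i ≤ j → ((F i : Type u) →ₗ[R] (F j : Type u))}
  {g : ∀ i, (F i : Type u) →ₗ[R] M}

theorem homSystemMittagLeffler_of_exists_factor (hg : IsDirectLimit R F u M g)
    (hu : IsDirectedSystem R F u)
    (h : ∀ i, ∃ (j : I) (hij : i ≤ j) (θ : M →ₗ[R] F j), θ.comp (g i) = u i j hij)
    (B : Type u) [AddCommGroup B] [Module R B] : HomSystemMittagLeffler R F u B := by
  intro i
  obtain ⟨j, hij, θ, hθ⟩ := h i
  refine ⟨j, hij, fun k hjk => Set.Subset.antisymm ?_ ?_⟩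
  · rintro _ ⟨f, rfl⟩
    exact ⟨f.comp (u j k hjk), by simp only [LinearMap.comp_assoc, hu.2]⟩
  · rintro _ ⟨f, rfl⟩
    refine ⟨f.comp (θ.comp (g k)), ?_⟩
    simp only [LinearMap.comp_assoc, hg.1, hθ]

variable [IsDirected I (· ≤ ·)] [Nonempty I]

theorem exists_factor_of_isStrictMittagLeffler (hM : IsStrictMittagLeffler R M)
    (hF : ∀ i, Module.FinitePresentation R (F i)) (hu : IsDirectedSystem R F u)
    (hg : IsDirectLimit R F u M g) (i : I) :
    ∃ (j : I) (hij : i ≤ j) (θ : M →ₗ[R] F j), θ.comp (g i) = u i j hij := by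
  classical
  let D := DirectSum I fun i => (F i : Type u)
  let π : D →ₗ[R] M := DirectSum.toModule R I M g
  have hπ : IsPureEpi R π := by
    refine ⟨fun m => ?_, fun A _ _ hA f => ?_⟩
    · obtain ⟨i, x, rfl⟩ := hg.2.1 m
      exact ⟨DirectSum.lof R I (fun i => (F i : Type u)) i x, DirectSum.toModule_lof ..⟩
    · obtain ⟨i, h, rfl⟩ := exists_factor_of_finitePresentation hu hg hA f
      refine ⟨(DirectSum.lof R I (fun i => (F i : Type u)) i).comp h, ?_⟩
      ext x
      exact DirectSum.toModule_lof ..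
  let p : ∀ j, D →ₗ[R] F j := fun j =>
    DirectSum.toModule R I (F j) fun k => if h : k ≤ j then u k j h else 0
  have hp : ∀ y : D, ∃ k, ∀ j, k ≤ j → g j (p j y) = π y := by
    intro y
    induction y using DirectSum.induction_on with
    | zero => exact ⟨i, by simp⟩
    | of k x =>
      refine ⟨k, fun j hj => ?_⟩
      change g j (p j (DirectSum.lof R I _ k x)) = π (DirectSum.lof R I _ k x)
      have h₁ : p j (DirectSum.lof R I _ k x) = u k j hj x :=
        (DirectSum.toModule_lof ..).trans (by rw [dif_pos hj])
      have h₂ : π (DirectSum.lof R I _ k x) = g k x := DirectSum.toModule_lof ..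
      rw [h₁, h₂]
      exact LinearMap.congr_fun (hg.1 k j hj) x
    | add y z hy hz =>
      obtain ⟨k, hk⟩ := hy
      obtain ⟨k', hk'⟩ := hz
      obtain ⟨n, hn, hn'⟩ := exists_ge_ge k k'
      exact ⟨n, fun j hj => by simp [hk j (hn.trans hj), hk' j (hn'.trans hj)]⟩
  obtain ⟨s, hs⟩ := (inferInstance : Module.Finite R (F i)).fg_top
  obtain ⟨φ, hφ⟩ := (hM D π hπ).2 (s.image (g i))
  choose k hk using hp
  obtain ⟨j₀, hj₀⟩ := Finite.exists_le fun x : s => k (φ (g i x))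
  obtain ⟨j, hij, hj⟩ := exists_ge_ge i j₀
  have heq : (g j).comp ((p j).comp (φ.comp (g i))) = g i := by
    refine LinearMap.ext_on hs fun x hx => ?_
    have := hk (φ (g i x)) j ((hj₀ ⟨x, hx⟩).trans hj)
    simp only [LinearMap.comp_apply]
    rw [this]
    exact hφ _ (Finset.mem_image_of_mem _ hx)
  obtain ⟨j', hjj', hz⟩ := exists_comp_eq_zero_on_fg hu hg (⟨s, hs⟩ : (⊤ : Submodule R (F i)).FG)
    ((p j).comp (φ.comp (g i)) - u i j hij) fun x _ => by
      have h₁ := LinearMap.congr_fun heq x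
      have h₂ := LinearMap.congr_fun (hg.1 i j hij) x
      simp only [LinearMap.comp_apply] at h₁ h₂
      simp [h₁, h₂]
  refine ⟨j', hij.trans hjj', (u j j' hjj').comp ((p j).comp φ), ?_⟩
  rw [← hu.2 i j j' hij hjj']
  ext x
  have := hz x trivial
  rw [LinearMap.sub_apply, map_sub, sub_eq_zero] at this
  exact this

theorem exists_factor_of_homSystemMittagLeffler (hF : ∀ i, IsPureInjective R (F i))
    (hu : IsDirectedSystem R F u) (hg : IsDirectLimit R F u M g)
    (hML : ∀ (B : Type u) [AddCommGroup B] [Module R B], HomSystemMittagLeffler R F u B) (i : I) :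
    ∃ (j : I) (hij : i ≤ j) (θ : M →ₗ[R] F j), θ.comp (g i) = u i j hij := by
  classical
  obtain ⟨j, hij, hj⟩ := hML (∀ k, (F k : Type u)) i
  have key : ∀ k (hjk : j ≤ k), ∃ h : (F k : Type u) →ₗ[R] F j,
      h.comp (u i k (hij.trans hjk)) = u i j hij := by
    intro k hjk
    obtain ⟨f, hf⟩ := (hj k hjk).ge ⟨LinearMap.single R (fun k => (F k : Type u)) j, rfl⟩
    refine ⟨(LinearMap.proj j).comp f, ?_⟩
    rw [LinearMap.comp_assoc, show f.comp _ = _ from hf, ← LinearMap.comp_assoc,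
      LinearMap.proj_comp_single_same, LinearMap.id_comp]
  choose h hh using key
  obtain ⟨L, hL, hL'⟩ := exists_limit (Filter.atTop : Filter I) (hF j)
  let h' : ∀ k, (F k : Type u) →ₗ[R] F j := fun k => if hk : j ≤ k then h k hk else 0
  let w : ∀ k, (F k : Type u) →ₗ[R] F j := fun k =>
    L.comp (LinearMap.pi fun n => if hkn : k ≤ n then (h' n).comp (u k n hkn) else 0)
  obtain ⟨θ, hθ⟩ := exists_desc hg w (by
    intro k n hkn
    ext x
    refine hL' _ _ ?_
    filter_upwards [Filter.eventually_ge_atTop n] with q hq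
    have := LinearMap.congr_fun (hu.2 k n q hkn hq) x
    rw [LinearMap.comp_apply] at this
    simp [hq, hkn.trans hq, this])
  refine ⟨j, hij, θ, ?_⟩
  rw [hθ]
  ext x
  refine Eq.trans (hL' _ (fun _ => u i j hij x) ?_) (hL _)
  filter_upwards [Filter.eventually_ge_atTop j] with q hq
  have := LinearMap.congr_fun (hh q hq) x
  rw [LinearMap.comp_apply] at this
  simp [hij.trans hq, h', hq, this]

theorem isSeparableModule_of_exists_factor (hF : ∀ i, Module.FinitePresentation R (F i))
    (hF' : ∀ i, IsPureInjective R (F i)) (hg : IsDirectLimit R F u M g)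
    (h : ∀ i, ∃ (j : I) (hij : i ≤ j) (θ : M →ₗ[R] F j), θ.comp (g i) = u i j hij) :
    IsSeparableModule R M := by
  intro S
  obtain ⟨i, hi⟩ := exists_preimage_finset hg S
  obtain ⟨j, hij, θ, hθ⟩ := h i
  obtain ⟨e, c, hee, hce, he⟩ := exists_idempotent_fixing (hF' j) (θ.comp (g j))
  let ψ : (F j : Type u) →ₗ[R] M := (g j).comp e
  let χ : M →ₗ[R] F j := (e.comp c).comp θ
  have hχψ : χ.comp ψ = e := by
    calc χ.comp ψ = e.comp ((c.comp (θ.comp (g j))).comp e) := rfl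
      _ = e := by rw [hce, hee, hee]
  have hψe : ψ.comp e = ψ := by rw [LinearMap.comp_assoc, hee]
  refine ⟨LinearMap.range ψ, ?_, ?_, ?_⟩
  · intro m hm
    obtain ⟨x, rfl⟩ := hi m hm
    have hgx : g j (u i j hij x) = g i x := LinearMap.congr_fun (hg.1 i j hij) x
    refine ⟨u i j hij x, ?_⟩
    have : e (u i j hij x) = u i j hij x := he _ (by
      rw [LinearMap.comp_apply, hgx]
      exact LinearMap.congr_fun hθ x)
    rw [LinearMap.comp_apply, this, hgx]
  · refine Module.finitePresentation_of_surjective ψ.rangeRestrict ψ.surjective_rangeRestrict ?_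
    have hker : LinearMap.ker ψ.rangeRestrict = LinearMap.range (LinearMap.id - e) := by
      rw [LinearMap.ker_rangeRestrict]
      ext x
      constructor
      · intro hx
        refine ⟨x, ?_⟩
        have : e x = 0 := by
          rw [← hχψ, LinearMap.comp_apply, LinearMap.mem_ker.1 hx, map_zero]
        simp [this]
      · rintro ⟨y, rfl⟩
        have := LinearMap.congr_fun hψe y
        rw [LinearMap.comp_apply] at this
        simp [this]
    rw [hker, LinearMap.range_eq_map]
    exact Module.Finite.fg_top.map _
  · refine ⟨ψ.rangeRestrict.comp χ, ?_⟩
    rintro ⟨_, x, rfl⟩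
    refine Subtype.ext ?_
    change ψ ((χ.comp ψ) x) = ψ x
    rw [hχψ]
    exact LinearMap.congr_fun hψe x

end

theorem isMittagLeffler_of_isStrictMittagLeffler (hM : IsStrictMittagLeffler R M) :
    IsMittagLeffler R M :=
  ⟨FPApprox R M, inferInstance, inferInstance, inferInstance, FPApprox.obj, FPApprox.trans,
    FPApprox.toModule, FPApprox.finitePresentation_obj, FPApprox.isDirectedSystem,
    FPApprox.isDirectLimit, fun B _ _ =>
      homSystemMittagLeffler_of_exists_factor FPApprox.isDirectLimit FPApprox.isDirectedSystem
        (exists_factor_of_isStrictMittagLeffler hM FPApprox.finitePresentation_obj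
          FPApprox.isDirectedSystem FPApprox.isDirectLimit) B⟩

theorem isSeparableModule_of_isMittagLeffler
    (hR : ∀ (F : Type u) [AddCommGroup F] [Module R F],
      Module.FinitePresentation R F → IsPureInjective R F)
    (hM : IsMittagLeffler R M) : IsSeparableModule R M := by
  obtain ⟨I, _, _, _, F, u, g, hF, hu, hg, hML⟩ := hM
  have hF' : ∀ i, IsPureInjective R (F i) := fun i => hR _ (hF i)
  exact isSeparableModule_of_exists_factor hF hF' hg
    (exists_factor_of_homSystemMittagLeffler hF' hu hg hML)

end MittagLefflerAux

/-- For a module `M` over a ring `R`: separable implies strict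
Mittag-Leffler, and strict Mittag-Leffler implies Mittag-Leffler. If moreover every
finitely presented `R`-module is pure-injective, the three notions are equivalent. -/
theorem separable_implies_strictML_implies_ML
    (R : Type u) [Ring R] (M : Type u) [AddCommGroup M] [Module R M] :
    (IsSeparableModule R M → IsStrictMittagLeffler R M) ∧
    (IsStrictMittagLeffler R M → IsMittagLeffler R M) ∧
    ((∀ (F : Type u) [AddCommGroup F] [Module R F],
        Module.FinitePresentation R F → IsPureInjective R F) →
      ((IsSeparableModule R M ↔ IsStrictMittagLeffler R M) ∧
        (IsStrictMittagLeffler R M ↔ IsMittagLeffler R M))) := by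
  have h₁ := MittagLefflerAux.isStrictMittagLeffler_of_isSeparableModule (R := R) (M := M)
  have h₂ := MittagLefflerAux.isMittagLeffler_of_isStrictMittagLeffler (R := R) (M := M)
  refine ⟨h₁, h₂, fun hR => ?_⟩
  have h₃ := MittagLefflerAux.isSeparableModule_of_isMittagLeffler (M := M) hR
  exact ⟨⟨h₁, h₃ ∘ h₂⟩, ⟨h₂, h₁ ∘ h₃⟩⟩
end

section
/- Let R be a ring, 𝒮 a class of finitely presented right R-modules, and B a right R-module such that every module in 𝒮 is a direct summand of a direct sum of copies of B. Let M be a right R-module that is the direct limit of some directed system of modules from 𝒮. Then the following statements are equivalent: (1) M is Mittag-Leffler; (2) there exists a directed system (F_α, u_{βα})_{α,β ∈ I} of modules in 𝒮 with direct limit M such that the inverse system (Hom_R(F_α, B), Hom_R(u_{βα}, B))_{α,β ∈ I} satisfies the Mittag-Leffler condition; (3) for every directed system (F_α, u_{βα})_{α,β ∈ I} of finitely presented right R-modules with direct limit M, the inverse system (Hom_R(F_α, B), Hom_R(u_{βα}, B))_{α,β ∈ I} satisfies the Mittag-Leffler condition. -/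
universe u

theorem IsDirectLimit.exists_comp_eq_zero {R : Type u} [Ring R] {I : Type u} [Preorder I]
    [IsDirected I (· ≤ ·)] [Nonempty I] {F : I → ModuleCat.{u} R}
    {u : ∀ i j : I, i ≤ j → ((F i : Type u) →ₗ[R] (F j : Type u))}
    {M : Type u} [AddCommGroup M] [Module R M] {g : ∀ i, (F i : Type u) →ₗ[R] M}
    (hu : IsDirectedSystem R F u) (hg : IsDirectLimit R F u M g)
    {N : Type u} [AddCommGroup N] [Module R N] [Module.Finite R N] {i : I}
    (f : N →ₗ[R] F i) (hf : (g i).comp f = 0) :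
    ∃ (j : I) (hij : i ≤ j), (u i j hij).comp f = 0 := by
  obtain ⟨s, hs⟩ := Module.Finite.fg_top (R := R) (M := N)
  choose c hc hc0 using fun x : s => hg.2.2 i (f x) (LinearMap.congr_fun hf x)
  obtain ⟨j₀, hj₀⟩ := Finite.exists_le c
  obtain ⟨j, hij, hj⟩ := exists_ge_ge i j₀
  refine ⟨j, hij, LinearMap.ext_on hs fun x hx => ?_⟩
  have h := hu.2 i (c ⟨x, hx⟩) j (hc _) ((hj₀ _).trans hj)
  rw [← h]
  simp [hc0 ⟨x, hx⟩]

theorem IsDirectLimit.exists_comp_eq {R : Type u} [Ring R] {I : Type u} [Preorder I]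
    [IsDirected I (· ≤ ·)] [Nonempty I] {F : I → ModuleCat.{u} R}
    {u : ∀ i j : I, i ≤ j → ((F i : Type u) →ₗ[R] (F j : Type u))}
    {M : Type u} [AddCommGroup M] [Module R M] {g : ∀ i, (F i : Type u) →ₗ[R] M}
    (hu : IsDirectedSystem R F u) (hg : IsDirectLimit R F u M g)
    {N : Type u} [AddCommGroup N] [Module R N] {i : I}
    [Module.Finite R N] (f f' : N →ₗ[R] F i) (hf : (g i).comp f = (g i).comp f') :
    ∃ (j : I) (hij : i ≤ j), (u i j hij).comp f = (u i j hij).comp f' := by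
  obtain ⟨j, hij, h⟩ := hg.exists_comp_eq_zero hu (f - f')
    (by rw [LinearMap.comp_sub, hf, sub_self])
  exact ⟨j, hij, by rwa [LinearMap.comp_sub, sub_eq_zero] at h⟩

theorem IsDirectLimit.exists_lift {R : Type u} [Ring R] {I : Type u} [Preorder I]
    [IsDirected I (· ≤ ·)] [Nonempty I] {F : I → ModuleCat.{u} R}
    {u : ∀ i j : I, i ≤ j → ((F i : Type u) →ₗ[R] (F j : Type u))}
    {M : Type u} [AddCommGroup M] [Module R M] {g : ∀ i, (F i : Type u) →ₗ[R] M}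
    (hu : IsDirectedSystem R F u) (hg : IsDirectLimit R F u M g)
    {N : Type u} [AddCommGroup N] [Module R N] [Module.FinitePresentation R N]
    (p : N →ₗ[R] M) : ∃ (i : I) (q : N →ₗ[R] F i), (g i).comp q = p := by
  obtain ⟨n, K, e, hK⟩ := Module.FinitePresentation.exists_fin R N
  let π : (Fin n → R) →ₗ[R] N := e.symm.toLinearMap.comp K.mkQ
  choose c x hx using fun k : Fin n => hg.2.1 (p (π (Pi.single k 1)))
  obtain ⟨a, ha⟩ := Finite.exists_le c
  let φ : (Fin n → R) →ₗ[R] F a := (Pi.basisFun R (Fin n)).constr ℕ fun k => u _ a (ha k) (x k)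
  have hφ : (g a).comp φ = p.comp π := (Pi.basisFun R (Fin n)).ext fun k => by
    have h := LinearMap.congr_fun (hg.1 _ a (ha k)) (x k)
    rw [LinearMap.comp_apply, LinearMap.comp_apply, Module.Basis.constr_basis,
      Pi.basisFun_apply, ← hx]
    exact h
  have : Module.Finite R K := Module.Finite.iff_fg.mpr hK
  obtain ⟨b, hab, hb⟩ := hg.exists_comp_eq_zero hu (φ.comp K.subtype) (by
    rw [← LinearMap.comp_assoc, hφ]
    ext y
    have hy : K.mkQ y = 0 := by simp
    simp only [π, LinearMap.comp_apply, Submodule.subtype_apply, hy, map_zero,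
      LinearMap.zero_apply])
  refine ⟨b, (K.liftQ ((u a b hab).comp φ) fun y hy =>
    LinearMap.congr_fun hb ⟨y, hy⟩).comp e.toLinearMap, ?_⟩
  ext y
  obtain ⟨z, rfl⟩ : ∃ z, π z = y := (e.symm.surjective.comp K.mkQ_surjective) y
  have h := LinearMap.congr_fun (hg.1 a b hab) (φ z)
  have h' := LinearMap.congr_fun hφ z
  simp only [LinearMap.comp_apply] at h h'
  rw [← h', ← h, LinearMap.comp_apply, LinearMap.comp_apply]
  refine congrArg (g b) ?_
  simp only [π, LinearMap.comp_apply, LinearEquiv.coe_coe, LinearEquiv.apply_symm_apply]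
  exact K.liftQ_apply _ z

theorem HomSystemMittagLeffler.of_isDirectLimit {R : Type u} [Ring R]
    {B : Type u} [AddCommGroup B] [Module R B] {M : Type u} [AddCommGroup M] [Module R M]
    {I : Type u} [Preorder I] [IsDirected I (· ≤ ·)] [Nonempty I] {F : I → ModuleCat.{u} R}
    {u : ∀ i j : I, i ≤ j → ((F i : Type u) →ₗ[R] (F j : Type u))}
    {f : ∀ i, (F i : Type u) →ₗ[R] M}
    (hF : ∀ i, Module.FinitePresentation R (F i))
    (hu : IsDirectedSystem R F u) (hf : IsDirectLimit R F u M f)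
    {J : Type u} [Preorder J] [IsDirected J (· ≤ ·)] [Nonempty J] {G : J → ModuleCat.{u} R}
    {v : ∀ i j : J, i ≤ j → ((G i : Type u) →ₗ[R] (G j : Type u))}
    {g : ∀ i, (G i : Type u) →ₗ[R] M}
    (hG : ∀ i, Module.FinitePresentation R (G i))
    (hv : IsDirectedSystem R G v) (hg : IsDirectLimit R G v M g)
    (hML : HomSystemMittagLeffler R F u B) : HomSystemMittagLeffler R G v B := by
  intro i
  obtain ⟨a, p, hp⟩ := hf.exists_lift hu (g i)
  obtain ⟨b, hab, hb⟩ := hML a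
  obtain ⟨j₀, q₀, hq₀⟩ := hg.exists_lift hv (f b)
  obtain ⟨j₁, hij₁, hj₀₁⟩ := exists_ge_ge i j₀
  obtain ⟨j, hj₁, hj⟩ := hg.exists_comp_eq hv (v i j₁ hij₁)
    ((v j₀ j₁ hj₀₁).comp (q₀.comp ((u a b hab).comp p))) (by
      rw [hg.1, ← LinearMap.comp_assoc, hg.1, ← LinearMap.comp_assoc, hq₀,
        ← LinearMap.comp_assoc, hf.1, hp])
  obtain ⟨q, hq, hvq⟩ : ∃ q : F b →ₗ[R] G j, (g j).comp q = f b ∧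
      v i j (hij₁.trans hj₁) = q.comp ((u a b hab).comp p) := by
    refine ⟨(v j₀ j (hj₀₁.trans hj₁)).comp q₀, ?_, ?_⟩
    · rw [← LinearMap.comp_assoc, hg.1, hq₀]
    · rw [← hv.2 i j₁ j hij₁ hj₁, hj, ← hv.2 j₀ j₁ j hj₀₁ hj₁]
      simp only [LinearMap.comp_assoc]
  refine ⟨j, hij₁.trans hj₁, fun k hjk => Set.Subset.antisymm ?_ ?_⟩
  · rintro _ ⟨h, rfl⟩
    exact ⟨h.comp (v j k hjk), by simp only [LinearMap.comp_assoc, hv.2]⟩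
  · rintro _ ⟨h, rfl⟩
    obtain ⟨c₀, s₀, hs₀⟩ := hf.exists_lift hu (g k)
    obtain ⟨c₁, hbc₁, hc₀₁⟩ := exists_ge_ge b c₀
    obtain ⟨c, hc₁, hc⟩ := hf.exists_comp_eq hu (u b c₁ hbc₁)
      ((u c₀ c₁ hc₀₁).comp (s₀.comp ((v j k hjk).comp q))) (by
        rw [hf.1, ← LinearMap.comp_assoc, hf.1, ← LinearMap.comp_assoc, hs₀,
          ← LinearMap.comp_assoc, hg.1, hq])
    obtain ⟨h', hh'⟩ := (hb c (hbc₁.trans hc₁)).ge ⟨h.comp q, rfl⟩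
    refine ⟨h'.comp ((u c₀ c (hc₀₁.trans hc₁)).comp s₀), ?_⟩
    have hbc : u b c (hbc₁.trans hc₁) =
        ((u c₀ c (hc₀₁.trans hc₁)).comp s₀).comp ((v j k hjk).comp q) := by
      rw [← hu.2 b c₁ c hbc₁ hc₁, hc, ← hu.2 c₀ c₁ c hc₀₁ hc₁]
      simp only [LinearMap.comp_assoc]
    calc (h'.comp ((u c₀ c (hc₀₁.trans hc₁)).comp s₀)).comp (v i k _)
        = (h'.comp (u a c (hab.trans (hbc₁.trans hc₁)))).comp p := by
          rw [← hu.2 a b c hab (hbc₁.trans hc₁), hbc, ← hv.2 i j k (hij₁.trans hj₁) hjk, hvq]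
          simp only [LinearMap.comp_assoc]
      _ = h.comp (v i j _) := by
          simp only at hh'
          rw [hh', hvq]
          simp only [LinearMap.comp_assoc]

/-- If `f : N → P` with `P` a finitely generated summand of a direct sum of copies of `B`, and every
homomorphism `P → B` composed with `f` factors through `w : N → Q`, then `f` factors through `w`. -/
theorem exists_comp_eq_of_directSum_retract {R : Type u} [Ring R]
    {B N P Q : Type u} [AddCommGroup B] [Module R B] [AddCommGroup N] [Module R N]
    [AddCommGroup P] [Module R P] [AddCommGroup Q] [Module R Q] [Module.Finite R P]
    {J : Type u} (ι : P →ₗ[R] DirectSum J fun _ => B) (r : (DirectSum J fun _ => B) →ₗ[R] P)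
    (hr : r.comp ι = LinearMap.id) (f : N →ₗ[R] P) (w : N →ₗ[R] Q)
    (H : ∀ h : P →ₗ[R] B, ∃ h' : Q →ₗ[R] B, h'.comp w = h.comp f) :
    ∃ t : Q →ₗ[R] P, t.comp w = f := by
  classical
  obtain ⟨s, hs⟩ := Module.Finite.fg_top (R := R) (M := P)
  let T : Finset J := s.biUnion fun x => DFinsupp.support (ι x)
  have hT : ∑ j ∈ T, (DirectSum.lof R J (fun _ => B) j).comp
      ((DirectSum.component R J (fun _ => B) j).comp ι) = ι := by
    refine LinearMap.ext_on hs fun x hx => DFinsupp.ext fun j => ?_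
    simp only [LinearMap.sum_apply, LinearMap.comp_apply]
    rw [DFinsupp.finsetSum_apply]
    by_cases hj : j ∈ T
    · rw [Finset.sum_eq_single_of_mem j hj]
      · exact DFinsupp.single_eq_same
      · intro b _ hb
        exact DFinsupp.single_eq_of_ne hb.symm
    · rw [Finset.sum_eq_zero]
      · by_contra h
        exact hj (Finset.mem_biUnion.mpr ⟨x, hx, DFinsupp.mem_support_iff.mpr (Ne.symm h)⟩)
      · intro b hb
        exact DFinsupp.single_eq_of_ne fun h => hj (h ▸ hb)
  choose h hh using fun j => H ((DirectSum.component R J (fun _ => B) j).comp ι)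
  refine ⟨r.comp (∑ j ∈ T, (DirectSum.lof R J (fun _ => B) j).comp (h j)), ?_⟩
  have hw : (∑ j ∈ T, (DirectSum.lof R J (fun _ => B) j).comp (h j)).comp w = ι.comp f := by
    ext1 y
    have hy := LinearMap.congr_fun hT (f y)
    have hh' := fun j => LinearMap.congr_fun (hh j) y
    simp only [LinearMap.comp_apply, LinearMap.sum_apply] at hy hh' ⊢
    simp only [hh', hy]
  rw [LinearMap.comp_assoc, hw, ← LinearMap.comp_assoc, hr, LinearMap.id_comp]

theorem HomSystemMittagLeffler.of_directSum_retract {R : Type u} [Ring R]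
    {B : Type u} [AddCommGroup B] [Module R B]
    {I : Type u} [Preorder I] {F : I → ModuleCat.{u} R}
    {u : ∀ i j : I, i ≤ j → ((F i : Type u) →ₗ[R] (F j : Type u))}
    (hu : IsDirectedSystem R F u) (hF : ∀ i, Module.Finite R (F i))
    (hB : ∀ i, ∃ (J : Type u) (ι : (F i : Type u) →ₗ[R] DirectSum J fun _ => B)
      (r : (DirectSum J fun _ => B) →ₗ[R] (F i : Type u)), r.comp ι = LinearMap.id)
    (hML : HomSystemMittagLeffler R F u B) (C : Type u) [AddCommGroup C] [Module R C] :
    HomSystemMittagLeffler R F u C := by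
  intro i
  obtain ⟨j, hij, hj⟩ := hML i
  refine ⟨j, hij, fun k hjk => Set.Subset.antisymm ?_ ?_⟩
  · rintro _ ⟨h, rfl⟩
    exact ⟨h.comp (u j k hjk), by simp only [LinearMap.comp_assoc, hu.2]⟩
  · rintro _ ⟨h, rfl⟩
    obtain ⟨J, ι, r, hr⟩ := hB j
    obtain ⟨t, ht⟩ := exists_comp_eq_of_directSum_retract ι r hr (u i j hij)
      (u i k (hij.trans hjk)) fun h => (hj k hjk).ge ⟨h, rfl⟩
    exact ⟨h.comp t, by simp only [LinearMap.comp_assoc, ht]⟩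

/-- Let `𝒮` be a class of finitely presented modules and `B` a module
such that every module in `𝒮` is a direct summand of a direct sum of copies of `B`. For a
module `M` which is the direct limit of a directed system of modules from `𝒮`, the
following are equivalent: (1) `M` is Mittag-Leffler; (2) some directed system in `𝒮` with
limit `M` has its Hom-inverse-system into `B` Mittag-Leffler; (3) every directed system of
finitely presented modules with limit `M` has its Hom-inverse-system into `B`
Mittag-Leffler. -/
theorem mittagLeffler_iff_homSystem_into_B
    (R : Type u) [Ring R] (𝒮 : Set (ModuleCat.{u} R))
    (h𝒮 : ∀ N ∈ 𝒮, Module.FinitePresentation R (N : Type u))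
    (B : Type u) [AddCommGroup B] [Module R B]
    (hB : ∀ N ∈ 𝒮, ∃ (J : Type u) (ι : (N : Type u) →ₗ[R] DirectSum J fun _ => B)
      (r : (DirectSum J fun _ => B) →ₗ[R] (N : Type u)), r.comp ι = LinearMap.id)
    (M : Type u) [AddCommGroup M] [Module R M]
    (hM : ∃ (I : Type u) (_ : Preorder I) (_ : IsDirected I (· ≤ ·)) (_ : Nonempty I)
      (F : I → ModuleCat.{u} R)
      (u : ∀ i j : I, i ≤ j → ((F i : Type u) →ₗ[R] (F j : Type u)))
      (g : ∀ i, (F i : Type u) →ₗ[R] M),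
        (∀ i, F i ∈ 𝒮) ∧ IsDirectedSystem R F u ∧ IsDirectLimit R F u M g) :
    (IsMittagLeffler R M ↔
      (∃ (I : Type u) (_ : Preorder I) (_ : IsDirected I (· ≤ ·)) (_ : Nonempty I)
        (F : I → ModuleCat.{u} R)
        (u : ∀ i j : I, i ≤ j → ((F i : Type u) →ₗ[R] (F j : Type u)))
        (g : ∀ i, (F i : Type u) →ₗ[R] M),
          (∀ i, F i ∈ 𝒮) ∧ IsDirectedSystem R F u ∧ IsDirectLimit R F u M g ∧
          HomSystemMittagLeffler R F u B)) ∧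
    (IsMittagLeffler R M ↔
      (∀ (I : Type u) [Preorder I], IsDirected I (· ≤ ·) → Nonempty I →
        ∀ (F : I → ModuleCat.{u} R)
          (u : ∀ i j : I, i ≤ j → ((F i : Type u) →ₗ[R] (F j : Type u)))
          (g : ∀ i, (F i : Type u) →ₗ[R] M),
          (∀ i, Module.FinitePresentation R (F i)) →
          IsDirectedSystem R F u → IsDirectLimit R F u M g →
          HomSystemMittagLeffler R F u B)) := by
  have forall_of_isML : IsMittagLeffler R M → ∀ (I : Type u) [Preorder I], IsDirected I (· ≤ ·) →
      Nonempty I → ∀ (F : I → ModuleCat.{u} R)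
        (u : ∀ i j : I, i ≤ j → ((F i : Type u) →ₗ[R] (F j : Type u)))
        (g : ∀ i, (F i : Type u) →ₗ[R] M),
        (∀ i, Module.FinitePresentation R (F i)) →
        IsDirectedSystem R F u → IsDirectLimit R F u M g →
        HomSystemMittagLeffler R F u B := by
    rintro ⟨I, _, _, _, F, u, f, hF, hu, hf, hML⟩ J _ _ _ G v g hG hv hg
    exact (hML B).of_isDirectLimit hF hu hf hG hv hg
  have isML_of_exists : (∃ (I : Type u) (_ : Preorder I) (_ : IsDirected I (· ≤ ·)) (_ : Nonempty I)
      (F : I → ModuleCat.{u} R)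
      (u : ∀ i j : I, i ≤ j → ((F i : Type u) →ₗ[R] (F j : Type u)))
      (g : ∀ i, (F i : Type u) →ₗ[R] M),
        (∀ i, F i ∈ 𝒮) ∧ IsDirectedSystem R F u ∧ IsDirectLimit R F u M g ∧
        HomSystemMittagLeffler R F u B) → IsMittagLeffler R M := by
    rintro ⟨I, hI, hI', hI'', F, u, g, hF, hu, hg, hML⟩
    refine ⟨I, hI, hI', hI'', F, u, g, fun i => h𝒮 _ (hF i), hu, hg, fun C _ _ => ?_⟩
    refine hML.of_directSum_retract hu (fun i => ?_) (fun i => hB _ (hF i)) C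
    have := h𝒮 _ (hF i)
    infer_instance
  obtain ⟨I, hI, hI', hI'', F, u, g, hF, hu, hg⟩ := hM
  exact ⟨⟨fun h => ⟨I, hI, hI', hI'', F, u, g, hF, hu, hg,
      forall_of_isML h I hI' hI'' F u g (fun i => h𝒮 _ (hF i)) hu hg⟩, isML_of_exists⟩,
    ⟨forall_of_isML, fun h => isML_of_exists ⟨I, hI, hI', hI'', F, u, g, hF, hu, hg,
      h I hI' hI'' F u g (fun i => h𝒮 _ (hF i)) hu hg⟩⟩⟩
end

section
/- Let R be a ring and M = ⊕_{i∈I} M_i a direct sum of finitely presented right R-modules. Then M is separable, and consequently M is strict Mittag-Leffler; that is, every pure epimorphism onto M is locally split. -/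
universe u

/-- A finitely presented direct summand containing a finite set lifts along a pure epimorphism,
and composing the lift with the projection gives a local splitting. -/
theorem IsSeparableModule.isStrictMittagLeffler {R : Type u} [Ring R] {M : Type u}
    [AddCommGroup M] [Module R M] (hM : IsSeparableModule R M) :
    IsStrictMittagLeffler R M := by
  intro X _ _ π hπ
  refine ⟨hπ.1, fun S => ?_⟩
  obtain ⟨N, hSN, hN, ρ, hρ⟩ := hM S
  obtain ⟨h, hh⟩ := hπ.2 N hN N.subtype
  refine ⟨h.comp ρ, fun m hm => ?_⟩
  have hρm : ρ m = ⟨m, hSN hm⟩ := hρ ⟨m, hSN hm⟩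
  simpa [hρm] using LinearMap.congr_fun hh ⟨m, hSN hm⟩

/-- The range of a split monomorphism is a direct summand. -/
theorem isDirectSummand_range_of_leftInverse {R : Type u} [Ring R] {M : Type u}
    [AddCommGroup M] [Module R M] {P : Type*} [AddCommGroup P] [Module R P]
    (f : P →ₗ[R] M) (g : M →ₗ[R] P) (hgf : Function.LeftInverse g f) :
    IsDirectSummand R (LinearMap.range f) := by
  refine ⟨f.rangeRestrict.comp g, ?_⟩
  rintro ⟨_, x, rfl⟩
  exact Subtype.ext (congrArg f (hgf x))

/-- A direct sum of finitely presented modules is separable: the elements of a finite set are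
supported on a common finite set of indices. -/
theorem isSeparableModule_directSum {R : Type u} [Ring R] {I : Type u} {Mi : I → Type u}
    [∀ i, AddCommGroup (Mi i)] [∀ i, Module R (Mi i)]
    (hfp : ∀ i, Module.FinitePresentation R (Mi i)) :
    IsSeparableModule R (DirectSum I Mi) := by
  classical
  intro S
  let T : Finset I := S.sup fun m => DFinsupp.support m
  let f := DirectSum.lmk R I Mi T
  let g : DirectSum I Mi →ₗ[R] ∀ i : (T : Set I), Mi i.val :=
    LinearMap.pi fun i => DirectSum.component R I Mi i.val
  have hgf : Function.LeftInverse g f := fun x => funext fun i =>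
    DFinsupp.mk_of_mem i.2
  refine ⟨LinearMap.range f, fun m hm => ⟨g m, DFinsupp.ext fun i => ?_⟩, ?_,
    isDirectSummand_range_of_leftInverse f g hgf⟩
  · by_cases hi : i ∈ T
    · exact DFinsupp.mk_of_mem hi
    · have hmi : m i = 0 := by
        by_contra hne
        exact hi (Finset.le_sup (f := fun m : DirectSum I Mi => DFinsupp.support m) hm
          (DFinsupp.mem_support_iff.mpr hne))
      exact (DFinsupp.mk_of_notMem hi).trans hmi.symm
  · exact .of_equiv (LinearEquiv.ofInjective f hgf.injective)

/-- A direct sum `M = ⊕_{i ∈ I} M_i` of finitely presented modules is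
separable, and consequently strict Mittag-Leffler: every pure epimorphism onto `M` is
locally split. -/
theorem directSum_finitelyPresented_separable_strictML
    (R : Type u) [Ring R] (I : Type u) (Mi : I → Type u)
    [∀ i, AddCommGroup (Mi i)] [∀ i, Module R (Mi i)]
    (hfp : ∀ i, Module.FinitePresentation R (Mi i)) :
    IsSeparableModule R (DirectSum I Mi) ∧ IsStrictMittagLeffler R (DirectSum I Mi) := by
  exact ⟨isSeparableModule_directSum hfp,
    (isSeparableModule_directSum hfp).isStrictMittagLeffler⟩
end

section
/- Let R be a ring and T a right R-module satisfying: (T1) there is an exact sequence 0 → P_1 → P_0 → T → 0 of right R-modules with P_0 and P_1 projective; (T2) Ext^1_R(T, T^{(I)}) = 0 for every index set I, where T^{(I)} denotes the direct sum of I copies of T; (T3) there is an exact sequence 0 → R → T_0 → T_1 → 0 where T_0 and T_1 are direct summands of direct sums of copies of T. Then for every right R-module X the following are equivalent: X is a homomorphic image of a direct sum of copies of T, and Ext^1_R(T, X) = 0. In other words, Gen(T) = T^{⊥}, where Gen(T) is the class of epimorphic images of direct sums of copies of T and T^{⊥} = {X : Ext^1_R(T,X) = 0}. -/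
universe u

open CategoryTheory

/-- Vanishing of the Ext group `Ext^n_R(M, N)` in the category of `R`-modules. -/
def extVanish (R : Type u) [Ring R] (n : ℕ) (M N : ModuleCat.{u} R) : Prop :=
  Subsingleton (((Ext ℤ (ModuleCat.{u} R) n).obj (Opposite.op M)).obj N)

/-- A map from a projective module into the kernel of `g` lifts along `f` when `f`, `g` are
exact. -/
lemma exists_lift_of_exact {R : Type*} [Ring R] {P A B C : Type*}
    [AddCommGroup P] [Module R P] [Module.Projective R P] [AddCommGroup A] [Module R A]
    [AddCommGroup B] [Module R B] [AddCommGroup C] [Module R C]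
    {f : A →ₗ[R] B} {g : B →ₗ[R] C} (hfg : Function.Exact f g)
    (h : P →ₗ[R] B) (hh : ∀ x, g (h x) = 0) :
    ∃ l : P →ₗ[R] A, ∀ x, f (l x) = h x := by
  obtain ⟨l, hl⟩ := Module.projective_lifting_property f.rangeRestrict
    (h.codRestrict (LinearMap.range f) fun x => (hfg _).1 (hh x)) f.surjective_rangeRestrict
  exact ⟨l, fun x => congrArg Subtype.val (LinearMap.congr_fun hl x)⟩

/-- Every linear map into `X` that vanishes on the image of `d₂` factors through `d₁`. -/
def ExactAfterHom {R : Type*} [Ring R] {A B C : Type*}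
    [AddCommGroup A] [Module R A] [AddCommGroup B] [Module R B] [AddCommGroup C] [Module R C]
    (d₂ : A →ₗ[R] B) (d₁ : B →ₗ[R] C) (X : Type*) [AddCommGroup X] [Module R X] : Prop :=
  ∀ h : B →ₗ[R] X, (∀ a, h (d₂ a) = 0) → ∃ k : C →ₗ[R] X, ∀ b, k (d₁ b) = h b

/-- Exactness of `Hom(-, X)` in degree one does not depend on the projective resolution. -/
lemma ExactAfterHom.of_resolution {R : Type*} [Ring R] {T A₀ A₁ A₂ B₀ B₁ B₂ X : Type*}
    [AddCommGroup T] [Module R T] [AddCommGroup X] [Module R X]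
    [AddCommGroup A₀] [Module R A₀] [AddCommGroup A₁] [Module R A₁]
    [AddCommGroup A₂] [Module R A₂] [AddCommGroup B₀] [Module R B₀]
    [AddCommGroup B₁] [Module R B₁] [AddCommGroup B₂] [Module R B₂]
    [Module.Projective R A₀] [Module.Projective R A₁]
    [Module.Projective R B₀] [Module.Projective R B₁]
    {p₂ : A₂ →ₗ[R] A₁} {p₁ : A₁ →ₗ[R] A₀} {p₀ : A₀ →ₗ[R] T}
    {q₂ : B₂ →ₗ[R] B₁} {q₁ : B₁ →ₗ[R] B₀} {q₀ : B₀ →ₗ[R] T}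
    (hp₂ : Function.Exact p₂ p₁) (hp₁ : Function.Exact p₁ p₀) (hp₀ : Function.Surjective p₀)
    (hq₂ : Function.Exact q₂ q₁) (hq₁ : Function.Exact q₁ q₀) (hq₀ : Function.Surjective q₀)
    (H : ExactAfterHom p₂ p₁ X) : ExactAfterHom q₂ q₁ X := by
  intro h hh
  obtain ⟨a, ha⟩ := Module.projective_lifting_property p₀ q₀ hp₀
  obtain ⟨b, hb⟩ := Module.projective_lifting_property q₀ p₀ hq₀
  replace ha : ∀ x, p₀ (a x) = q₀ x := LinearMap.congr_fun ha
  replace hb : ∀ x, q₀ (b x) = p₀ x := LinearMap.congr_fun hb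
  obtain ⟨a₁, ha₁⟩ := exists_lift_of_exact hp₁ (a ∘ₗ q₁)
    fun x => by simp [ha, hq₁.apply_apply_eq_zero]
  obtain ⟨b₁, hb₁⟩ := exists_lift_of_exact hq₁ (b ∘ₗ p₁)
    fun x => by simp [hb, hp₁.apply_apply_eq_zero]
  obtain ⟨c, hc⟩ := exists_lift_of_exact hq₁ (b ∘ₗ a - LinearMap.id)
    fun x => by simp [hb, ha]
  simp only [LinearMap.comp_apply, LinearMap.sub_apply, LinearMap.id_apply] at ha₁ hb₁ hc
  have vanish : ∀ y, q₁ y = 0 → h y = 0 := by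
    intro y hy
    obtain ⟨z, rfl⟩ := (hq₂ y).1 hy
    exact hh z
  obtain ⟨k, hk⟩ := H (h ∘ₗ b₁)
    fun x => vanish _ (by rw [hb₁, hp₂.apply_apply_eq_zero, map_zero])
  refine ⟨k ∘ₗ a - h ∘ₗ c, fun x => ?_⟩
  have key := vanish (b₁ (a₁ x) - c (q₁ x) - x) (by simp [hb₁, ha₁, hc])
  simp only [map_sub] at key
  rw [LinearMap.sub_apply, LinearMap.comp_apply, LinearMap.comp_apply, ← ha₁, hk]
  exact sub_eq_zero.1 key

/-- `Ext¹(T, X)` vanishes iff `Hom(-, X)` is exact in degree one on a projective resolution. -/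
lemma extVanish_one_iff_projectiveResolution {R : Type u} [Ring R] {T X : ModuleCat.{u} R}
    (P : ProjectiveResolution T) :
    extVanish R 1 T X ↔
      ExactAfterHom (P.complex.d 2 1).hom (P.complex.d 1 0).hom X := by
  have h1 : extVanish R 1 T X ↔ (P.complex.linearYonedaObj ℤ X).ExactAt 1 := by
    rw [HomologicalComplex.exactAt_iff_isZero_homology, extVanish,
      ← (P.isoExt (R := ℤ) 1 X).isZero_iff, ModuleCat.isZero_iff_subsingleton]
  rw [h1, HomologicalComplex.exactAt_iff' _ 0 1 2 (by simp) (by simp),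
    ShortComplex.moduleCat_exact_iff]
  constructor
  · intro H h hh
    obtain ⟨k, hk⟩ := H (ModuleCat.ofHom h : P.complex.X 1 ⟶ X)
      (ModuleCat.hom_ext (LinearMap.ext hh))
    exact ⟨ModuleCat.Hom.hom (k : P.complex.X 0 ⟶ X), fun b =>
      LinearMap.congr_fun (congrArg ModuleCat.Hom.hom hk) b⟩
  · intro H (h : P.complex.X 1 ⟶ X) hh
    obtain ⟨k, hk⟩ := H h.hom
      fun a => LinearMap.congr_fun (congrArg ModuleCat.Hom.hom hh) a
    exact ⟨(ModuleCat.ofHom k : P.complex.X 0 ⟶ X), ModuleCat.hom_ext (LinearMap.ext hk)⟩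

/-- If `0 → P₁ → P₀ → T → 0` is exact with `P₀`, `P₁` projective, then `Ext¹(T, X)` vanishes
iff every map `P₁ → X` extends to `P₀`. -/
lemma extVanish_one_iff_extends {R : Type u} [Ring R] {T P₀ P₁ : Type u}
    [AddCommGroup T] [Module R T] [AddCommGroup P₀] [Module R P₀] [AddCommGroup P₁] [Module R P₁]
    [Module.Projective R P₀] [Module.Projective R P₁]
    {f : P₁ →ₗ[R] P₀} {g : P₀ →ₗ[R] T}
    (hf : Function.Injective f) (hg : Function.Surjective g) (hfg : Function.Exact f g)
    (X : Type u) [AddCommGroup X] [Module R X] :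
    extVanish R 1 (ModuleCat.of R T) (ModuleCat.of R X) ↔
      ∀ h : P₁ →ₗ[R] X, ∃ k : P₀ →ₗ[R] X, ∀ y, k (f y) = h y := by
  have P : ProjectiveResolution (ModuleCat.of R T) := ProjectiveResolution.of _
  have hproj (n : ℕ) : Module.Projective R (P.complex.X n) :=
    (IsProjective.iff_projective _).2 (P.projective n)
  let p₀ : P.complex.X 0 →ₗ[R] T := (P.π.f 0).hom
  have e₁ : Function.Exact (P.complex.d 2 1).hom (P.complex.d 1 0).hom :=
    (CategoryTheory.ShortComplex.ShortExact.moduleCat_exact_iff_function_exact _).1 (P.exact_succ 0)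
  have e₀ : Function.Exact (P.complex.d 1 0).hom p₀ :=
    (CategoryTheory.ShortComplex.ShortExact.moduleCat_exact_iff_function_exact _).1 P.exact₀
  have s₀ : Function.Surjective p₀ := (ModuleCat.epi_iff_surjective _).1 inferInstance
  have e : Function.Exact (0 : P₁ →ₗ[R] P₁) f := by
    intro y
    simp [map_eq_zero_iff f hf, eq_comm]
  have hiff : ExactAfterHom (0 : P₁ →ₗ[R] P₁) f X ↔
      ∀ h : P₁ →ₗ[R] X, ∃ k : P₀ →ₗ[R] X, ∀ y, k (f y) = h y :=
    ⟨fun H h => H h (by simp), fun H h _ => H h⟩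
  rw [extVanish_one_iff_projectiveResolution P, ← hiff]
  exact ⟨.of_resolution e₁ e₀ s₀ e hfg hg, .of_resolution e hfg hg e₁ e₀ s₀⟩

/-- If every map `Q₁ → X` extends along `i : Q₁ → Q₀`, where `Q₁ → Q₀ → N → 0` is exact with `Q₀`
projective, then maps into `X` extend along any injection whose cokernel is a direct summand
of `N`. -/
lemma exists_extension_of_retract_cokernel {R : Type*} [Ring R] {A M N N' Q₀ Q₁ X : Type*}
    [AddCommGroup A] [Module R A] [AddCommGroup M] [Module R M] [AddCommGroup N] [Module R N]
    [AddCommGroup N'] [Module R N'] [AddCommGroup Q₀] [Module R Q₀] [AddCommGroup Q₁] [Module R Q₁]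
    [AddCommGroup X] [Module R X] [Module.Projective R Q₀] [Module.Projective R Q₁]
    {i : Q₁ →ₗ[R] Q₀} {p : Q₀ →ₗ[R] N} (hp : Function.Surjective p) (hip : Function.Exact i p)
    (H : ∀ h : Q₁ →ₗ[R] X, ∃ k : Q₀ →ₗ[R] X, ∀ y, k (i y) = h y)
    {f : A →ₗ[R] M} {g : M →ₗ[R] N'} (hf : Function.Injective f) (hg : Function.Surjective g)
    (hfg : Function.Exact f g) {s : N' →ₗ[R] N} {r : N →ₗ[R] N'} (hrs : ∀ x, r (s x) = x)
    (h : A →ₗ[R] X) : ∃ k : M →ₗ[R] X, ∀ y, k (f y) = h y := by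
  obtain ⟨a, ha⟩ := Module.projective_lifting_property g (r ∘ₗ p) hg
  replace ha : ∀ x, g (a x) = r (p x) := LinearMap.congr_fun ha
  obtain ⟨b, hb⟩ := exists_lift_of_exact hfg (a ∘ₗ i)
    fun x => by simp [ha, hip.apply_apply_eq_zero]
  obtain ⟨l, hl⟩ := H (h ∘ₗ b)
  simp only [LinearMap.comp_apply] at hb hl
  have ex (t : M) : ∃ x : X, ∃ q y, p q = s (g t) ∧ t = f y + a q ∧ x = h y + l q := by
    obtain ⟨q, hq⟩ := hp (s (g t))
    obtain ⟨y, hy⟩ := (hfg (t - a q)).1 (by rw [map_sub, ha, hq, hrs, sub_self])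
    exact ⟨_, q, y, hq, by rw [hy, sub_add_cancel], rfl⟩
  have vanish : ∀ q y, p q = 0 → f y + a q = 0 → h y + l q = 0 := by
    intro q y hq hy
    obtain ⟨z, rfl⟩ := (hip q).1 hq
    rw [← hb, ← map_add, map_eq_zero_iff f hf] at hy
    rw [hl, ← map_add, hy, map_zero]
  choose k q y hq ht hk using ex
  have uniq : ∀ t q' y', p q' = s (g t) → t = f y' + a q' → k t = h y' + l q' := by
    intro t q' y' hq' ht'
    have := vanish (q t - q') (y t - y') (by rw [map_sub, hq, hq', sub_self]) (by
      rw [map_sub, map_sub, sub_add_sub_comm, ← ht, ← ht', sub_self])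
    rw [map_sub, map_sub, sub_add_sub_comm, ← hk] at this
    exact sub_eq_zero.1 this
  refine ⟨{ toFun := k, map_add' := fun t u => ?_, map_smul' := fun c t => ?_ }, fun z => ?_⟩
  · rw [uniq (t + u) (q t + q u) (y t + y u) (by simp only [map_add, hq])
      (by rw [map_add, map_add, add_add_add_comm, ← ht, ← ht]), hk, hk]
    simp only [map_add]
    abel
  · rw [uniq (c • t) (c • q t) (c • y t) (by simp only [map_smul, hq])
      (by rw [map_smul, map_smul, ← smul_add, ← ht]), hk]
    simp
  · exact (uniq (f z) 0 z (by simp [hfg.apply_apply_eq_zero]) (by simp)).trans (by simp)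

/-- For a (1-)tilting module `T` — i.e. `T` has projective dimension at
most one witnessed by an exact sequence `0 → P₁ → P₀ → T → 0` with `P₀, P₁` projective
(T1), `Ext^1_R(T, T^{(I)}) = 0` for every index set `I` (T2), and there is an exact
sequence `0 → R → T₀ → T₁ → 0` with `T₀, T₁` direct summands of direct sums of copies of
`T` (T3) — a module `X` is an epimorphic image of a direct sum of copies of `T` if and
only if `Ext^1_R(T, X) = 0`; that is, `Gen(T) = T^⊥`. -/
theorem gen_eq_perp_of_tilting
    (R : Type u) [Ring R] (T : Type u) [AddCommGroup T] [Module R T]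
    (hT1 : ∃ (P₀ P₁ : ModuleCat.{u} R)
      (f : (P₁ : Type u) →ₗ[R] (P₀ : Type u)) (g : (P₀ : Type u) →ₗ[R] T),
        Module.Projective R (P₀ : Type u) ∧ Module.Projective R (P₁ : Type u) ∧
        Function.Injective f ∧ Function.Surjective g ∧ Function.Exact f g)
    (hT2 : ∀ I : Type u,
      extVanish R 1 (ModuleCat.of R T) (ModuleCat.of R (DirectSum I fun _ => T)))
    (hT3 : ∃ (T₀ T₁ : ModuleCat.{u} R)
      (f : R →ₗ[R] (T₀ : Type u)) (g : (T₀ : Type u) →ₗ[R] (T₁ : Type u)),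
        Function.Injective f ∧ Function.Surjective g ∧ Function.Exact f g ∧
        (∃ (J : Type u) (ι : (T₀ : Type u) →ₗ[R] DirectSum J fun _ => T)
          (r : (DirectSum J fun _ => T) →ₗ[R] (T₀ : Type u)), r.comp ι = LinearMap.id) ∧
        (∃ (J : Type u) (ι : (T₁ : Type u) →ₗ[R] DirectSum J fun _ => T)
          (r : (DirectSum J fun _ => T) →ₗ[R] (T₁ : Type u)), r.comp ι = LinearMap.id)) :
    ∀ (X : Type u) [AddCommGroup X] [Module R X],
      (∃ (I : Type u) (φ : (DirectSum I fun _ => T) →ₗ[R] X), Function.Surjective φ) ↔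
        extVanish R 1 (ModuleCat.of R T) (ModuleCat.of R X) := by
  classical
  obtain ⟨P₀, P₁, f, g, _, _, hf, hg, hfg⟩ := hT1
  obtain ⟨T₀, T₁, f', g', hf', hg', hfg', ⟨J₀, ι₀, r₀, hr₀⟩, ⟨J, ι, r, hr⟩⟩ := hT3
  intro X _ _
  rw [extVanish_one_iff_extends hf hg hfg]
  constructor
  · rintro ⟨I, φ, hφ⟩ h
    obtain ⟨h', hh'⟩ := Module.projective_lifting_property φ h hφ
    obtain ⟨k, hk⟩ := (extVanish_one_iff_extends hf hg hfg _).1 (hT2 I) h'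
    exact ⟨φ ∘ₗ k, fun y => by
      rw [LinearMap.comp_apply, hk, ← LinearMap.comp_apply, hh']⟩
  · intro H
    have hsurj : Function.Surjective (DirectSum.lmap fun _ : J => g) :=
      (DirectSum.lmap_surjective _).2 fun _ => hg
    have hexact : Function.Exact (DirectSum.lmap fun _ : J => f)
        (DirectSum.lmap fun _ : J => g) := by
      rw [LinearMap.exact_iff, DirectSum.ker_lmap, DirectSum.range_lmap,
        LinearMap.exact_iff.1 hfg]
    have hext (h : (DirectSum J fun _ => (P₁ : Type u)) →ₗ[R] X) :
        ∃ k : (DirectSum J fun _ => (P₀ : Type u)) →ₗ[R] X,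
          ∀ y, k (DirectSum.lmap (fun _ => f) y) = h y := by
      choose k hk using fun j => H (h ∘ₗ DirectSum.lof R J (fun _ => (P₁ : Type u)) j)
      refine ⟨DirectSum.toModule R J X k, LinearMap.congr_fun
        (f := DirectSum.toModule R J X k ∘ₗ DirectSum.lmap fun _ => f)
        (DirectSum.linearMap_ext R fun j => LinearMap.ext fun y => ?_)⟩
      simpa using hk j y
    have hgen (x : X) : ∃ k : (DirectSum J₀ fun _ => T) →ₗ[R] X, ∃ t, k t = x := by
      obtain ⟨k, hk⟩ := exists_extension_of_retract_cokernel hsurj hexact hext hf' hg' hfg'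
        (LinearMap.congr_fun hr) (LinearMap.toSpanSingleton R X x)
      refine ⟨k ∘ₗ r₀, ι₀ (f' 1), ?_⟩
      rw [LinearMap.comp_apply, ← LinearMap.comp_apply r₀, hr₀, LinearMap.id_apply, hk]
      simp
    refine ⟨T →ₗ[R] X, DirectSum.toModule R _ X fun k => k, ?_⟩
    rw [← LinearMap.range_eq_top, eq_top_iff]
    rintro x -
    obtain ⟨k, t, rfl⟩ := hgen x
    induction t using DirectSum.induction_on with
    | zero => simp
    | of j t =>
      exact ⟨DirectSum.lof R (T →ₗ[R] X) (fun _ => T) (k ∘ₗ DirectSum.lof R J₀ (fun _ => T) j) t,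
        by rw [DirectSum.toModule_lof]; rfl⟩
    | add t u ht hu => rw [map_add]; exact add_mem ht hu
end

section
/- Let R be a right hereditary ring, G a right R-module, κ an index set, and M a right R-module admitting an injective homomorphism M → G^{(κ)}, where G^{(κ)} denotes the direct sum of κ copies of G. Then for every right R-module Y with Ext^1_R(G, Y) = 0 one has Ext^1_R(M, Y) = 0. -/
universe u

open CategoryTheory

/-- A ring is (right) hereditary: every submodule of a projective module is projective. -/
def IsHereditaryRing (R : Type u) [Ring R] : Prop :=
  ∀ (P : Type u) [AddCommGroup P] [Module R P], Module.Projective R P →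
    ∀ N : Submodule R P, Module.Projective R N

/-- `Ext^1` vanishing in terms of a projective resolution. -/
lemma extVanish_one_iff {R : Type u} [Ring R] {X : ModuleCat.{u} R}
    (Q : ProjectiveResolution X) (Y : ModuleCat.{u} R) :
    extVanish R 1 X Y ↔ ∀ g : Q.complex.X 1 ⟶ Y, Q.complex.d 2 1 ≫ g = 0 →
      ∃ h : Q.complex.X 0 ⟶ Y, Q.complex.d 1 0 ≫ h = g := by
  rw [extVanish, ← ModuleCat.isZero_iff_subsingleton, (Q.isoExt (R := ℤ) 1 Y).isZero_iff,
    ← HomologicalComplex.exactAt_iff_isZero_homology,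
    HomologicalComplex.exactAt_iff' _ 0 1 2 (by simp) (by simp),
    ShortComplex.moduleCat_exact_iff]
  rfl

section Presentation

variable {R : Type u} [Ring R] {X Y : Type u} [AddCommGroup X] [Module R X]
  [AddCommGroup Y] [Module R Y]

/-- Every linear map from the submodule `K` to `Y` extends to the ambient module. -/
def ExtendsFrom {P : Type u} [AddCommGroup P] [Module R P] (K : Submodule R P)
    (Y : Type u) [AddCommGroup Y] [Module R Y] : Prop :=
  ∀ φ : K →ₗ[R] Y, ∃ ψ : P →ₗ[R] Y, ψ ∘ₗ K.subtype = φ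

/-- The extension property of the kernel does not depend on the projective presentation. -/
lemma ExtendsFrom.of_projective {P P' : Type u} [AddCommGroup P] [Module R P]
    [AddCommGroup P'] [Module R P'] [Module.Projective R P] [Module.Projective R P']
    {p : P →ₗ[R] X} {p' : P' →ₗ[R] X} (hp : Function.Surjective p)
    (hp' : Function.Surjective p') (h : ExtendsFrom (LinearMap.ker p) Y) :
    ExtendsFrom (LinearMap.ker p') Y := by
  intro φ
  obtain ⟨a, ha⟩ := Module.projective_lifting_property p p' hp
  obtain ⟨b, hb⟩ := Module.projective_lifting_property p' p hp'
  have ha' (x) : p (a x) = p' x := LinearMap.congr_fun ha x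
  have hb' (x) : p' (b x) = p x := LinearMap.congr_fun hb x
  obtain ⟨u, hu⟩ := h (φ ∘ₗ b.restrict (p := LinearMap.ker p) (q := LinearMap.ker p')
    fun x hx => by simpa [hb'] using hx)
  refine ⟨φ ∘ₗ (LinearMap.id - b ∘ₗ a).codRestrict (LinearMap.ker p')
    (fun x => by simp [hb', ha']) + u ∘ₗ a, ?_⟩
  ext ⟨x, hx⟩
  have hax : a x ∈ LinearMap.ker p := by simpa [ha'] using hx
  have hux := LinearMap.congr_fun hu ⟨a x, hax⟩
  simp only [LinearMap.comp_apply, Submodule.subtype_apply] at hux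
  simp only [LinearMap.comp_apply, Submodule.subtype_apply, LinearMap.add_apply, hux, ← map_add]
  congr 1
  ext
  simp

lemma extVanish_one_iff_extendsFrom {P : Type u} [AddCommGroup P] [Module R P]
    [Module.Projective R P] {p : P →ₗ[R] X} (hp : Function.Surjective p) :
    extVanish R 1 (ModuleCat.of R X) (ModuleCat.of R Y) ↔
      ExtendsFrom (LinearMap.ker p) Y := by
  let Q := projectiveResolution (ModuleCat.of R X)
  let q : Q.complex.X 0 →ₗ[R] X := (Q.π.f 0).hom
  have hq : Function.Surjective q := (ModuleCat.epi_iff_surjective (Q.π.f 0)).1 inferInstance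
  have : Module.Projective R (Q.complex.X 0) :=
    (IsProjective.iff_projective _).2 (Q.projective 0)
  trans ExtendsFrom (LinearMap.ker q) Y
  swap
  · exact ⟨fun h => h.of_projective hq hp, fun h => h.of_projective hp hq⟩
  rw [extVanish_one_iff Q]
  have hrange : LinearMap.range (Q.complex.d 1 0).hom = LinearMap.ker q :=
    Q.exact₀.moduleCat_range_eq_ker
  have hmem (x) : (Q.complex.d 1 0).hom x ∈ LinearMap.ker q := hrange ▸ ⟨x, rfl⟩
  let d : Q.complex.X 1 →ₗ[R] LinearMap.ker q := (Q.complex.d 1 0).hom.codRestrict _ hmem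
  have hd : Function.Surjective d := by
    rintro ⟨x, hx⟩
    obtain ⟨y, rfl⟩ := hrange.symm ▸ hx
    exact ⟨y, rfl⟩
  have hker : LinearMap.range (Q.complex.d 2 1).hom = LinearMap.ker d := by
    rw [LinearMap.ker_codRestrict]
    exact (Q.exact_succ 0).moduleCat_range_eq_ker
  constructor
  · intro h φ
    obtain ⟨ψ, hψ⟩ := h (ModuleCat.ofHom (φ ∘ₗ d)) (by
      ext x
      have : d ((Q.complex.d 2 1).hom x) = 0 := LinearMap.mem_ker.1 (hker ▸ ⟨x, rfl⟩)
      simp [this])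
    refine ⟨ψ.hom, ?_⟩
    rw [← LinearMap.cancel_right hd]
    exact congrArg ModuleCat.Hom.hom hψ
  · intro h g hg
    have hgker : LinearMap.ker d ≤ LinearMap.ker g.hom := by
      rw [← hker, LinearMap.range_le_ker_iff]
      exact congrArg ModuleCat.Hom.hom hg
    obtain ⟨ψ, hψ⟩ := h ((LinearMap.ker d).liftQ g.hom hgker ∘ₗ
      (d.quotKerEquivOfSurjective hd).symm.toLinearMap)
    refine ⟨ModuleCat.ofHom ψ, ?_⟩
    ext x
    have hx : (d.quotKerEquivOfSurjective hd).symm (d x) = (LinearMap.ker d).mkQ x := by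
      rw [LinearEquiv.symm_apply_eq]
      rfl
    have := LinearMap.congr_fun hψ (d x)
    simp only [LinearMap.comp_apply, LinearEquiv.coe_coe, hx] at this
    exact this

open DirectSum in
lemma ExtendsFrom.directSum {P : Type u} [AddCommGroup P] [Module R P] {p : P →ₗ[R] X}
    (h : ExtendsFrom (LinearMap.ker p) Y) (κ : Type u) :
    ExtendsFrom (LinearMap.ker (DirectSum.lmap fun _ : κ => p)) Y := by
  classical
  intro φ
  have hmem (i : κ) (x) (hx : x ∈ LinearMap.ker p) : lof R κ (fun _ => P) i x ∈
      LinearMap.ker (DirectSum.lmap fun _ : κ => p) := by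
    rw [LinearMap.mem_ker] at hx ⊢
    rw [DirectSum.lmap_lof, hx, map_zero]
  choose ψ hψ using fun i : κ => h (φ ∘ₗ (lof R κ (fun _ => P) i).restrict (hmem i))
  refine ⟨DirectSum.toModule R κ Y ψ, ?_⟩
  ext ⟨x, hx⟩
  have hx' (i : κ) : x i ∈ LinearMap.ker p := by
    exact DFunLike.congr_fun (LinearMap.mem_ker.1 hx) i
  have hsum : (⟨x, hx⟩ : LinearMap.ker (DirectSum.lmap fun _ : κ => p)) =
      ∑ i ∈ DFinsupp.support x, ⟨lof R κ (fun _ => P) i (x i), hmem i _ (hx' i)⟩ := by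
    ext1
    simpa [lof_eq_of] using (DirectSum.sum_support_of x).symm
  rw [hsum, map_sum, map_sum]
  refine Finset.sum_congr rfl fun i _ => ?_
  exact (DirectSum.toModule_lof (φ := ψ) R i (x i)).trans (LinearMap.congr_fun (hψ i) ⟨x i, hx' i⟩)

/-- Over a hereditary ring, `Ext^1` vanishing passes to submodules: the preimage of a submodule
under a projective presentation is a projective presentation with the same kernel. -/
lemma extVanish_one_of_injective (hR : IsHereditaryRing R) {P : Type u} [AddCommGroup P]
    [Module R P] [Module.Projective R P] {π : P →ₗ[R] X} (hπ : Function.Surjective π)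
    (h : ExtendsFrom (LinearMap.ker π) Y) {M : Type u} [AddCommGroup M] [Module R M]
    (f : M →ₗ[R] X) (hf : Function.Injective f) :
    extVanish R 1 (ModuleCat.of R M) (ModuleCat.of R Y) := by
  let N := (LinearMap.range f).comap π
  have : Module.Projective R N := hR P inferInstance N
  let e := LinearEquiv.ofInjective f hf
  let r : N →ₗ[R] M := e.symm.toLinearMap ∘ₗ π.restrict fun _ hx => hx
  have hr : Function.Surjective r := by
    refine e.symm.surjective.comp ?_
    rintro ⟨y, hy⟩
    obtain ⟨x, rfl⟩ := hπ y
    exact ⟨⟨x, hy⟩, rfl⟩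
  refine (extVanish_one_iff_extendsFrom hr).2 ?_
  intro φ
  have hmem {x} (hx : x ∈ LinearMap.ker π) : x ∈ N := by
    simp [N, LinearMap.mem_ker.1 hx]
  have hker {x : N} : x ∈ LinearMap.ker r ↔ x.1 ∈ LinearMap.ker π := by
    simp [r, Subtype.ext_iff]
  let ι : LinearMap.ker π →ₗ[R] LinearMap.ker r :=
    ((LinearMap.ker π).subtype.codRestrict N fun x => hmem x.2).codRestrict _
      fun x => hker.2 x.2
  obtain ⟨ψ, hψ⟩ := h (φ ∘ₗ ι)
  refine ⟨ψ ∘ₗ N.subtype, ?_⟩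
  ext x
  exact LinearMap.congr_fun hψ ⟨x.1.1, hker.1 x.2⟩

end Presentation

/-- Over a hereditary ring, if `M` embeds in a direct sum of copies of
`G`, then `Ext^1_R(G, Y) = 0` implies `Ext^1_R(M, Y) = 0` for every module `Y`. -/
theorem ext_vanish_of_embeds_in_directSum
    (R : Type u) [Ring R] (hR : IsHereditaryRing R)
    (G : Type u) [AddCommGroup G] [Module R G] (κ : Type u)
    (M : Type u) [AddCommGroup M] [Module R M]
    (f : M →ₗ[R] DirectSum κ fun _ => G) (hf : Function.Injective f) :
    ∀ (Y : Type u) [AddCommGroup Y] [Module R Y],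
      extVanish R 1 (ModuleCat.of R G) (ModuleCat.of R Y) →
      extVanish R 1 (ModuleCat.of R M) (ModuleCat.of R Y) := by
  intro Y _ _ hG
  let p : (G →₀ R) →ₗ[R] G := Finsupp.linearCombination R id
  have hp : Function.Surjective p := Finsupp.linearCombination_id_surjective R G
  let π : DirectSum κ (fun _ => G →₀ R) →ₗ[R] DirectSum κ fun _ => G := DirectSum.lmap fun _ => p
  have hπ : Function.Surjective π := (DirectSum.lmap_surjective _).2 fun _ => hp
  exact extVanish_one_of_injective hR hπ
    (((extVanish_one_iff_extendsFrom hp).1 hG).directSum κ) f hf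
end
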